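/- arXiv:2204.04703 — 2 statements merged into one kernel-verified Lean document; each statement's English description precedes it below -/
import Mathlib

section
/- Explicit eigenfunctions for q = p': let 1 < p < ∞, t₀ > 0, c > 0 and n ∈ ℕ, n ≥ 1. The function f(x) = c·sin_{2,p'}(π_{2,p'}·n·x/t₀) satisfies (⌊f''⌉^{p-1})'' = λ·⌊f⌉^{p'-1} on [0, t₀] with f(0) = f(t₀) = f''(0) = f''(t₀) = 0, where λ = ((p'·π_{2,p'}²·n²)/(2t₀²))^p · c^{p - p'}. -/
/-- Signed power ⌊x⌉^r = |x|^r · sgn x. -/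
noncomputable def spow (r x : ℝ) : ℝ := |x| ^ r * Real.sign x

open Set Filter Topology MeasureTheory

lemma spow_neg_right (r x : ℝ) : spow r (-x) = -spow r x := by
  simp [spow, Real.sign_neg]

lemma spow_mul_of_pos (r : ℝ) {a : ℝ} (ha : 0 < a) (x : ℝ) :
    spow r (a * x) = a ^ r * spow r x := by
  unfold spow
  rw [abs_mul, abs_of_pos ha, Real.mul_rpow ha.le (abs_nonneg x), mul_assoc]
  congr 2
  rcases lt_trichotomy x 0 with hx | rfl | hx
  · rw [Real.sign_of_neg hx, Real.sign_of_neg (mul_neg_of_pos_of_neg ha hx)]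
  · rw [mul_zero]
  · rw [Real.sign_of_pos hx, Real.sign_of_pos (mul_pos ha hx)]

lemma spow_spow_of_mul_eq_one {r q : ℝ} (h : q * r = 1) (x : ℝ) : spow r (spow q x) = x := by
  unfold spow
  rcases lt_trichotomy x 0 with hx | rfl | hx
  · have h1 : 0 < |x| ^ q := Real.rpow_pos_of_pos (abs_pos.2 hx.ne) q
    rw [Real.sign_of_neg hx, mul_neg_one, abs_neg, abs_of_pos h1, Real.sign_of_neg (by linarith),
      ← Real.rpow_mul (abs_nonneg x), h, Real.rpow_one, abs_of_neg hx]
    ring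
  · simp
  · have h1 : 0 < |x| ^ q := Real.rpow_pos_of_pos (abs_pos.2 hx.ne') q
    rw [Real.sign_of_pos hx, mul_one, abs_of_pos h1, Real.sign_of_pos h1,
      ← Real.rpow_mul (abs_nonneg x), h, Real.rpow_one, abs_of_pos hx]
    ring

lemma spow_sub_one (s x : ℝ) : spow (s - 1) x = |x| ^ (s - 2) * x := by
  unfold spow
  rcases eq_or_ne x 0 with rfl | hx
  · simp
  · have h : x = |x| * Real.sign x := by
      rcases lt_or_gt_of_ne hx with h | h
      · rw [abs_of_neg h, Real.sign_of_neg h]; ring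
      · rw [abs_of_pos h, Real.sign_of_pos h]; ring
    have e : s - 1 = (s - 2) + 1 := by ring
    rw [e, Real.rpow_add_one (abs_ne_zero.2 hx)]
    conv_rhs => rw [h, abs_mul, abs_abs]
    rw [show |Real.sign x| = 1 by rcases Real.sign_apply_eq_of_ne_zero x hx with h | h <;> simp [h]]
    ring_nf

/-- The odd integral function inverted by `sin_{2,s}` on its central arch. -/
noncomputable def arcsinTwo (s y : ℝ) : ℝ := ∫ t in (0:ℝ)..y, (1 - |t| ^ s) ^ (-(1/2 : ℝ))

lemma one_sub_abs_rpow_pos {s y : ℝ} (hs : 1 < s) (hy : |y| < 1) : 0 < 1 - |y| ^ s :=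
  sub_pos.2 (Real.rpow_lt_one (abs_nonneg y) hy (by linarith))

lemma continuous_one_sub_abs_rpow {s : ℝ} (hs : 1 < s) :
    Continuous fun t : ℝ => 1 - |t| ^ s :=
  continuous_const.sub (continuous_abs.rpow_const fun _ => Or.inr (by linarith))

lemma measurable_arcsinTwo_integrand (s : ℝ) :
    Measurable fun t : ℝ => (1 - |t| ^ s) ^ (-(1/2 : ℝ)) := by
  fun_prop

lemma intervalIntegrable_arcsinTwo_zero_one {s : ℝ} (hs : 1 < s) :
    IntervalIntegrable (fun t : ℝ => (1 - |t| ^ s) ^ (-(1/2 : ℝ))) volume 0 1 := by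
  have h1 : IntervalIntegrable (fun t : ℝ => (1 - t) ^ (-(1/2 : ℝ))) volume 0 1 := by
    have := (intervalIntegral.intervalIntegrable_rpow' (a := 0) (b := 1)
      (r := -(1/2 : ℝ)) (by norm_num)).comp_sub_left 1
    simpa using this.symm
  refine h1.mono_fun (measurable_arcsinTwo_integrand s).aestronglyMeasurable ?_
  rw [uIoc_of_le zero_le_one, ← restrict_Ioo_eq_restrict_Ioc]
  refine (ae_restrict_iff' measurableSet_Ioo).2 (Eventually.of_forall fun t ht => ?_)
  have ht1 : |t| < 1 := by rw [abs_of_pos ht.1]; exact ht.2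
  have hp := one_sub_abs_rpow_pos hs ht1
  beta_reduce
  have hle : 1 - t ≤ 1 - |t| ^ s := by
    rw [abs_of_pos ht.1]
    have := Real.rpow_le_rpow_of_exponent_ge ht.1 ht.2.le hs.le
    rw [Real.rpow_one] at this
    linarith
  rw [Real.norm_of_nonneg (Real.rpow_nonneg hp.le _),
    Real.norm_of_nonneg (Real.rpow_nonneg (by linarith [ht.2]) _)]
  exact Real.rpow_le_rpow_of_nonpos (by linarith [ht.2]) hle (by norm_num)

lemma intervalIntegrable_arcsinTwo {s : ℝ} (hs : 1 < s) :
    IntervalIntegrable (fun t : ℝ => (1 - |t| ^ s) ^ (-(1/2 : ℝ))) volume (-1) 1 := by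
  have h := intervalIntegrable_arcsinTwo_zero_one hs
  have h2 := h.comp_sub_left 0
  simp only [zero_sub, abs_neg, sub_zero] at h2
  exact h2.symm.trans h

lemma continuousOn_arcsinTwo {s : ℝ} (hs : 1 < s) : ContinuousOn (arcsinTwo s) (Icc (-1) 1) := by
  have h := intervalIntegral.continuousOn_primitive_interval' (a := 0)
    (intervalIntegrable_arcsinTwo hs) (by rw [uIcc_of_le (by norm_num)]; norm_num)
  rwa [uIcc_of_le (by norm_num)] at h

lemma hasStrictDerivAt_arcsinTwo {s y : ℝ} (hs : 1 < s) (hy : y ∈ Ioo (-1 : ℝ) 1) :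
    HasStrictDerivAt (arcsinTwo s) ((1 - |y| ^ s) ^ (-(1/2 : ℝ))) y := by
  have hp := one_sub_abs_rpow_pos hs (abs_lt.2 hy)
  refine intervalIntegral.integral_hasStrictDerivAt_right ?_
    (measurable_arcsinTwo_integrand s).stronglyMeasurable.stronglyMeasurableAtFilter
    ((continuous_one_sub_abs_rpow hs).continuousAt.rpow_const (Or.inl hp.ne'))
  refine (intervalIntegrable_arcsinTwo hs).mono_set ?_
  rw [uIcc_of_le (by norm_num : (-1 : ℝ) ≤ 1)]
  exact uIcc_subset_Icc (by norm_num) (Ioo_subset_Icc_self hy)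

lemma strictMonoOn_arcsinTwo {s : ℝ} (hs : 1 < s) : StrictMonoOn (arcsinTwo s) (Icc (-1) 1) := by
  refine strictMonoOn_of_deriv_pos (convex_Icc _ _) (continuousOn_arcsinTwo hs) fun y hy => ?_
  rw [interior_Icc] at hy
  rw [(hasStrictDerivAt_arcsinTwo hs hy).hasDerivAt.deriv]
  exact Real.rpow_pos_of_pos (one_sub_abs_rpow_pos hs (abs_lt.2 hy)) _

lemma arcsinTwo_neg (s y : ℝ) : arcsinTwo s (-y) = -arcsinTwo s y := by
  unfold arcsinTwo
  have h := intervalIntegral.integral_comp_neg (a := 0) (b := y)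
    fun t : ℝ => (1 - |t| ^ s) ^ (-(1/2 : ℝ))
  simp only [abs_neg, neg_zero] at h
  rw [h, intervalIntegral.integral_symm]

lemma arcsinTwo_of_nonneg (s : ℝ) {y : ℝ} (hy : 0 ≤ y) :
    arcsinTwo s y = ∫ t in (0:ℝ)..y, (1 - t ^ s) ^ (-(1/2 : ℝ)) := by
  refine intervalIntegral.integral_congr fun t ht => ?_
  rw [uIcc_of_le hy] at ht
  simp only [abs_of_nonneg ht.1]

lemma arcsinTwo_one_pos {s : ℝ} (hs : 1 < s) : 0 < arcsinTwo s 1 := by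
  have h0 : arcsinTwo s 0 = 0 := by simp [arcsinTwo]
  rw [← h0]
  exact strictMonoOn_arcsinTwo hs (by norm_num) (by norm_num) zero_lt_one

lemma exists_arcsinTwo_eq {s x : ℝ} (hs : 1 < s)
    (hx : x ∈ Ioo (-arcsinTwo s 1) (arcsinTwo s 1)) :
    ∃ y ∈ Ioo (-1 : ℝ) 1, arcsinTwo s y = x := by
  have := intermediate_value_Ioo (by norm_num : (-1 : ℝ) ≤ 1) (continuousOn_arcsinTwo hs)
  rw [arcsinTwo_neg] at this
  exact this hx

/-- A one-sided derivative propagates through a reflection symmetry compatible with it. -/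
lemma HasDerivWithinAt.hasDerivAt_of_reflection {g : ℝ → ℝ} {a d ε : ℝ}
    (h : HasDerivWithinAt g d (Iic a) a) (hrefl : ∀ x, g (2 * a - x) = ε * g x)
    (hε : ε * ε = 1) (hd : -(ε * d) = d) : HasDerivAt g d a := by
  have hsub : HasDerivWithinAt (fun x : ℝ => 2 * a - x) (-1) (Ici a) a :=
    ((hasDerivAt_id' a).const_sub (2 * a)).hasDerivWithinAt
  have h' : HasDerivWithinAt g d (Iic a) (2 * a - a) := by
    rwa [show 2 * a - a = a by ring]
  have hmaps : MapsTo (fun x : ℝ => 2 * a - x) (Ici a) (Iic a) := fun x hx => by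
    simp only [mem_Ici, mem_Iic] at *
    linarith
  have h2 := (h'.comp a hsub hmaps).const_mul ε
  have h3 : HasDerivWithinAt g d (Ici a) a := by
    have hfun : ∀ x, g x = ε * (g ∘ fun x => 2 * a - x) x := fun x => by
      rw [Function.comp_apply, hrefl, ← mul_assoc, hε, one_mul]
    exact (h2.congr_deriv (by linarith)).congr (fun x _ => hfun x) (hfun a)
  have := h.union h3
  rwa [Iic_union_Ici, hasDerivWithinAt_univ] at this

section GeneralizedSine

variable {s : ℝ} {sn : ℝ → ℝ}

lemma hasDerivAt_of_inverse_arcsinTwo (hs : 1 < s)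
    (hinv : ∀ y ∈ Icc (-1 : ℝ) 1, sn (arcsinTwo s y) = y) {x : ℝ}
    (hx : x ∈ Ioo (-arcsinTwo s 1) (arcsinTwo s 1)) :
    |sn x| < 1 ∧ HasDerivAt sn ((1 - |sn x| ^ s) ^ (1/2 : ℝ)) x := by
  obtain ⟨y, hy, rfl⟩ := exists_arcsinTwo_eq hs hx
  rw [hinv y (Ioo_subset_Icc_self hy)]
  refine ⟨abs_lt.2 hy, ?_⟩
  have hp := one_sub_abs_rpow_pos hs (abs_lt.2 hy)
  have h := (hasStrictDerivAt_arcsinTwo hs hy).to_local_left_inverse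
    (Real.rpow_pos_of_pos hp _).ne' (g := sn)
    (by filter_upwards [Icc_mem_nhds hy.1 hy.2] with z hz using hinv z hz)
  rw [← Real.rpow_neg hp.le, neg_neg] at h
  exact h.hasDerivAt

lemma tendsto_left_of_inverse_arcsinTwo (hs : 1 < s)
    (hinv : ∀ y ∈ Icc (-1 : ℝ) 1, sn (arcsinTwo s y) = y) :
    Tendsto sn (𝓝[<] (arcsinTwo s 1)) (𝓝 1) := by
  have hpos := arcsinTwo_one_pos hs
  have hmem : Ioo (-arcsinTwo s 1) (arcsinTwo s 1) ∈ 𝓝[<] (arcsinTwo s 1) :=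
    Ioo_mem_nhdsLT (by linarith)
  refine tendsto_order.2 ⟨fun a ha => ?_, fun a ha => ?_⟩
  · have hm : max a 0 < 1 := max_lt ha zero_lt_one
    have hm' : max a 0 ∈ Icc (-1 : ℝ) 1 := ⟨by linarith [le_max_right a 0], hm.le⟩
    filter_upwards [hmem, Ioo_mem_nhdsLT (strictMonoOn_arcsinTwo hs hm' (by norm_num) hm)]
      with x hx hx2
    obtain ⟨y, hy, rfl⟩ := exists_arcsinTwo_eq hs hx
    rw [hinv y (Ioo_subset_Icc_self hy)]
    exact (le_max_left a 0).trans_lt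
      (((strictMonoOn_arcsinTwo hs).lt_iff_lt hm' (Ioo_subset_Icc_self hy)).1 hx2.1)
  · filter_upwards [hmem] with x hx
    exact ((abs_lt.1 (hasDerivAt_of_inverse_arcsinTwo hs hinv hx).1).2).trans ha

lemma hasDerivAt_deriv_of_inverse_arcsinTwo (hs : 1 < s)
    (hinv : ∀ y ∈ Icc (-1 : ℝ) 1, sn (arcsinTwo s y) = y) {x : ℝ}
    (hx : x ∈ Ioo (-arcsinTwo s 1) (arcsinTwo s 1)) :
    HasDerivAt (deriv sn) (-(s / 2) * spow (s - 1) (sn x)) x := by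
  obtain ⟨hlt, hd⟩ := hasDerivAt_of_inverse_arcsinTwo hs hinv hx
  have hp := one_sub_abs_rpow_pos hs hlt
  have h1 := (((hasDerivAt_abs_rpow (sn x) hs).comp x hd).const_sub 1).rpow_const
    (p := (1/2 : ℝ)) (Or.inl hp.ne')
  have heq : deriv sn =ᶠ[𝓝 x] fun z => (1 - |sn z| ^ s) ^ (1/2 : ℝ) := by
    filter_upwards [Ioo_mem_nhds hx.1 hx.2] with z hz
    exact (hasDerivAt_of_inverse_arcsinTwo hs hinv hz).2.deriv
  refine HasDerivAt.congr_of_eventuallyEq ?_ heq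
  have h3 : (1 - |sn x| ^ s) ^ (1/2 : ℝ) * (1 - |sn x| ^ s) ^ ((1/2 : ℝ) - 1) = 1 := by
    rw [← Real.rpow_add hp]
    norm_num
  refine h1.congr_deriv ?_
  rw [spow_sub_one, Function.comp_apply]
  linear_combination -(s / 2 * |sn x| ^ (s - 2) * sn x) * h3

lemma hasDerivAt_of_inverse_arcsinTwo_right (hs : 1 < s)
    (hinv : ∀ y ∈ Icc (-1 : ℝ) 1, sn (arcsinTwo s y) = y)
    (hsym : ∀ x, sn (2 * arcsinTwo s 1 - x) = sn x) :
    HasDerivAt sn 0 (arcsinTwo s 1) ∧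
      HasDerivAt (deriv sn) (-(s / 2) * spow (s - 1) (sn (arcsinTwo s 1))) (arcsinTwo s 1) := by
  have hpos := arcsinTwo_one_pos hs
  have hmem : Ioo (-arcsinTwo s 1) (arcsinTwo s 1) ∈ 𝓝[<] (arcsinTwo s 1) :=
    Ioo_mem_nhdsLT (by linarith)
  have hlim := tendsto_left_of_inverse_arcsinTwo hs hinv
  have hsub : 𝓝[Ioo (-arcsinTwo s 1) (arcsinTwo s 1)] (arcsinTwo s 1) ≤ 𝓝[<] (arcsinTwo s 1) :=
    nhdsWithin_mono _ Ioo_subset_Iio_self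
  have hone : sn (arcsinTwo s 1) = 1 := hinv 1 (by norm_num)
  have hdlim : Tendsto (deriv sn) (𝓝[<] (arcsinTwo s 1)) (𝓝 0) := by
    have h1 := (((continuous_one_sub_abs_rpow hs).tendsto 1).comp hlim).rpow_const
      (p := (1/2 : ℝ)) (Or.inr (by norm_num))
    have h2 : (1 - |(1 : ℝ)| ^ s) ^ (1/2 : ℝ) = 0 := by norm_num
    rw [h2] at h1
    refine h1.congr' ?_
    filter_upwards [hmem] with z hz
    exact (hasDerivAt_of_inverse_arcsinTwo hs hinv hz).2.deriv.symm
  have hd : HasDerivAt sn 0 (arcsinTwo s 1) := by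
    refine HasDerivWithinAt.hasDerivAt_of_reflection (ε := 1)
      (hasDerivWithinAt_Iic_of_tendsto_deriv (fun z hz =>
        (hasDerivAt_of_inverse_arcsinTwo hs hinv hz).2.differentiableAt.differentiableWithinAt)
        ?_ hmem hdlim) (fun x => by rw [hsym, one_mul]) (by norm_num) (by norm_num)
    rw [ContinuousWithinAt, hone]
    exact hlim.mono_left hsub
  refine ⟨hd, HasDerivWithinAt.hasDerivAt_of_reflection (ε := -1)
      (hasDerivWithinAt_Iic_of_tendsto_deriv (fun z hz =>
        (hasDerivAt_deriv_of_inverse_arcsinTwo hs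
          hinv hz).differentiableAt.differentiableWithinAt)
        ?_ hmem ?_) (fun x => ?_) (by norm_num) (by ring)⟩
  · rw [ContinuousWithinAt, hd.deriv]
    exact hdlim.mono_left hsub
  · have hc : ContinuousAt (fun y : ℝ => -(s / 2) * spow (s - 1) y) 1 := by
      simp only [spow_sub_one]
      exact continuousAt_const.mul
        ((continuous_abs.continuousAt.rpow_const (Or.inl (by norm_num))).mul continuousAt_id)
    rw [hone]
    refine (hc.tendsto.comp hlim).congr' ?_
    filter_upwards [hmem] with z hz
    exact (hasDerivAt_deriv_of_inverse_arcsinTwo hs hinv hz).deriv.symm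
  · have h := deriv_comp_const_sub (f := sn) (2 * arcsinTwo s 1) x
    simp only [hsym] at h
    linarith

/-- The generalized sine is differentiable, with second derivative `-(s/2) ⌊sn⌉^(s-1)`, on the whole
line. -/
lemma hasDerivAt_generalizedSine (hs : 1 < s)
    (hinv : ∀ y ∈ Icc (-1 : ℝ) 1, sn (arcsinTwo s y) = y)
    (hsym : ∀ x, sn (2 * arcsinTwo s 1 - x) = sn x) (hodd : ∀ x, sn (-x) = -sn x) (x : ℝ) :
    HasDerivAt sn (deriv sn x) x ∧
      HasDerivAt (deriv sn) (-(s / 2) * spow (s - 1) (sn x)) x := by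
  set b := 2 * arcsinTwo s 1 with hb
  have hpos : 0 < b := by have := arcsinTwo_one_pos hs; positivity
  have hanti : ∀ z, sn (z + b) = -sn z := fun z => by
    rw [← hodd, ← hsym]
    congr 1
    ring
  have hdanti : ∀ z, deriv sn (z + b) = -deriv sn z := fun z => by
    rw [← deriv_comp_add_const]
    simp only [hanti]
    exact deriv.fun_neg
  let Q : ℝ → Prop := fun z => HasDerivAt sn (deriv sn z) z ∧
    HasDerivAt (deriv sn) (-(s / 2) * spow (s - 1) (sn z)) z
  have hiff : ∀ z, Q (z + b) ↔ Q z := by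
    intro z
    constructor
    · rintro ⟨h1, h2⟩
      have h1' := (h1.comp_add_const z b).neg
      have h2' := (h2.comp_add_const z b).neg
      rw [hdanti, neg_neg] at h1'
      rw [hanti, spow_neg_right] at h2'
      exact ⟨h1'.congr_of_eventuallyEq (Eventually.of_forall fun w => by simp [hanti]),
        (h2'.congr_deriv (by ring)).congr_of_eventuallyEq
          (Eventually.of_forall fun w => by simp [hdanti])⟩
    · rintro ⟨h1, h2⟩
      rw [show z = (z + b) - b by ring] at h1 h2
      have h1' := (h1.comp_sub_const (z + b) b).neg
      have h2' := (h2.comp_sub_const (z + b) b).neg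
      have e1 : ∀ w, -sn (w - b) = sn w := fun w => by rw [← hanti]; congr 1; ring
      have e2 : ∀ w, -deriv sn (w - b) = deriv sn w := fun w => by rw [← hdanti]; congr 1; ring
      rw [e2] at h1'
      exact ⟨h1'.congr_of_eventuallyEq (Eventually.of_forall fun w => by simp [e1]),
        (h2'.congr_deriv (by rw [← e1 (z + b), spow_neg_right]; ring)).congr_of_eventuallyEq
          (Eventually.of_forall fun w => by simp [e2])⟩
  have hbase : ∀ z ∈ Ioc (-arcsinTwo s 1) (arcsinTwo s 1), Q z := by
    intro z hz
    rcases eq_or_lt_of_le hz.2 with rfl | hlt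
    · obtain ⟨h1, h2⟩ := hasDerivAt_of_inverse_arcsinTwo_right hs hinv hsym
      exact ⟨h1.differentiableAt.hasDerivAt, h2⟩
    · exact ⟨(hasDerivAt_of_inverse_arcsinTwo hs hinv
        ⟨hz.1, hlt⟩).2.differentiableAt.hasDerivAt,
        hasDerivAt_deriv_of_inverse_arcsinTwo hs hinv ⟨hz.1, hlt⟩⟩
  have hper : Function.Periodic Q b := fun z => propext (hiff z)
  obtain ⟨z, hz, hQ⟩ := hper.exists_mem_Ioc hpos x (-arcsinTwo s 1)
  change Q x
  rw [hQ]
  exact hbase z ⟨hz.1, by linarith [hz.2]⟩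

end GeneralizedSine

/-- explicit eigenfunctions when q = p'.  With s = p' = p/(p-1) and
f(x) = c·sin_{2,p'}(π_{2,p'}·n·x/t₀), one has (⌊f''⌉^{p-1})'' = λ⌊f⌉^{p'-1} on [0,t₀]
with Navier boundary conditions, for λ = ((p'·π_{2,p'}²·n²)/(2t₀²))^p·c^{p-p'}. -/
theorem stmt15 (p t₀ c : ℝ) (n : ℕ) (hp : 1 < p) (ht₀ : 0 < t₀) (hc : 0 < c) (hn : 1 ≤ n)
    (sn : ℝ → ℝ) (π₀ : ℝ)
    (hπ : π₀ = 2 * ∫ t in (0:ℝ)..1, (1 - t ^ (p / (p - 1))) ^ (-(1/2 : ℝ)))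
    (hinv : ∀ y ∈ Set.Icc (0:ℝ) 1,
      sn (∫ t in (0:ℝ)..y, (1 - t ^ (p / (p - 1))) ^ (-(1/2 : ℝ))) = y)
    (hodd : ∀ x, sn (-x) = -sn x)
    (hper : ∀ x, sn (x + 2 * π₀) = sn x)
    (hsym : ∀ x, sn (π₀ - x) = sn x)
    (f : ℝ → ℝ) (hf : ∀ x, f x = c * sn (π₀ * n * x / t₀))
    (lam : ℝ)
    (hlam : lam = ((p / (p - 1) * π₀ ^ 2 * (n : ℝ) ^ 2) / (2 * t₀ ^ 2)) ^ p *
      c ^ (p - p / (p - 1))) :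
    (∀ x ∈ Set.Icc (0:ℝ) t₀,
        deriv (deriv fun y => spow (p - 1) (deriv (deriv f) y)) x =
          lam * spow (p / (p - 1) - 1) (f x)) ∧
      f 0 = 0 ∧ f t₀ = 0 ∧ deriv (deriv f) 0 = 0 ∧ deriv (deriv f) t₀ = 0 := by
  set s := p / (p - 1) with hsdef
  have hp1 : 0 < p - 1 := by linarith
  have hs : 1 < s := by rw [hsdef, lt_div_iff₀ hp1]; linarith
  have hπ' : π₀ = 2 * arcsinTwo s 1 := by rw [hπ, arcsinTwo_of_nonneg s zero_le_one]
  have hinv' : ∀ y ∈ Icc (-1 : ℝ) 1, sn (arcsinTwo s y) = y := by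
    intro y hy
    rcases le_total 0 y with h | h
    · rw [arcsinTwo_of_nonneg s h]
      exact hinv y ⟨h, hy.2⟩
    · have e : arcsinTwo s y = -arcsinTwo s (-y) := by rw [arcsinTwo_neg, neg_neg]
      rw [e, hodd, arcsinTwo_of_nonneg s (by linarith), hinv (-y) ⟨by linarith, by linarith [hy.1]⟩,
        neg_neg]
  have hD := hasDerivAt_generalizedSine hs hinv' (fun x => by rw [← hπ', hsym]) hodd
  have hπpos : 0 < π₀ := by rw [hπ']; have := arcsinTwo_one_pos hs; positivity
  have hn' : (0 : ℝ) < n := by exact_mod_cast hn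
  set k := π₀ * n / t₀ with hk
  have hkpos : 0 < k := by positivity
  have hfk : ∀ x, f x = c * sn (k * x) := fun x => by
    rw [hf, hk]
    congr 2
    ring
  have hsnk : ∀ x, HasDerivAt (fun y => sn (k * y)) (k * deriv sn (k * x)) x := fun x => by
    have h := (hD (k * x)).1.comp x ((hasDerivAt_id' x).const_mul k)
    exact h.congr_deriv (by ring)
  have hdsnk : ∀ x, HasDerivAt (fun y => deriv sn (k * y))
      (k * (-(s / 2) * spow (s - 1) (sn (k * x)))) x := fun x => by
    have h := (hD (k * x)).2.comp x ((hasDerivAt_id' x).const_mul k)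
    exact h.congr_deriv (by ring)
  have hf1 : deriv f = fun x => c * (k * deriv sn (k * x)) := by
    rw [funext hfk]
    funext x
    exact ((hsnk x).const_mul c).deriv
  set A := k ^ 2 * s / 2 with hA
  have hApos : 0 < A := by positivity
  have hf2 : deriv (deriv f) = fun x => -(c * A * spow (s - 1) (sn (k * x))) := by
    rw [hf1]
    funext x
    rw [(((hdsnk x).const_mul k).const_mul c).deriv, hA]
    ring
  have hexp : (s - 1) * (p - 1) = 1 := by rw [hsdef]; field_simp; ring
  have hg : (fun y => spow (p - 1) (deriv (deriv f) y)) =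
      fun y => -(c * A) ^ (p - 1) * sn (k * y) := by
    funext y
    rw [hf2]
    simp only []
    rw [spow_neg_right, spow_mul_of_pos _ (mul_pos hc hApos), spow_spow_of_mul_eq_one hexp]
    ring
  have hg1 : deriv (fun y => -(c * A) ^ (p - 1) * sn (k * y)) =
      fun y => -(c * A) ^ (p - 1) * (k * deriv sn (k * y)) := by
    funext y
    exact ((hsnk y).const_mul _).deriv
  have hlam' : lam = A ^ p * c ^ (p - s) := by
    rw [hlam, hA, hk]
    congr 2
    field_simp
  have hsn0 : sn 0 = 0 := by
    have h := hodd 0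
    rw [neg_zero] at h
    linarith
  have hsnn : ∀ m : ℕ, sn (π₀ * m) = 0 := by
    intro m
    induction m with
    | zero => simpa using hsn0
    | succ m ih =>
      rw [← hsym, ← neg_neg (π₀ - _), hodd,
        show -(π₀ - π₀ * ((m + 1 : ℕ) : ℝ)) = π₀ * m by push_cast; ring, ih, neg_zero]
  have hkt : k * t₀ = π₀ * n := by rw [hk]; field_simp
  refine ⟨fun x _ => ?_, ?_, ?_, ?_, ?_⟩
  · rw [hg, hg1, (((hdsnk x).const_mul k).const_mul _).deriv, hfk, spow_mul_of_pos _ hc, hlam']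
    have e1 : c ^ (p - s) * c ^ (s - 1) = c ^ (p - 1) := by
      rw [← Real.rpow_add hc]; ring_nf
    have e2 : A ^ p = A ^ (p - 1) * A := by
      rw [← Real.rpow_add_one hApos.ne']; ring_nf
    rw [Real.mul_rpow hc.le hApos.le, e2, ← e1, hA]
    ring
  · rw [hfk, mul_zero, hsn0, mul_zero]
  · rw [hfk, hkt, hsnn, mul_zero]
  · simp [hf2, hsn0, spow]
  · simp [hf2, hkt, hsnn, spow]
end

section
/- Norm of the second-order embedding when q = p': for 1 < p < ∞ and I = [0, π_{2,p'}], sup over nonzero f ∈ W^{2,p}_D(I) of ‖f‖_{L^{p'}(I)}/‖f''‖_{L^p(I)} equals (2/p')^{2/p'}·B(1/2, (p'+1)/p')^{1/p' - 1/p}, and the extremal functions are exactly the nonzero scalar multiples of sin_{2,p'}. -/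
/-- Euler Beta function B(a,b) = ∫₀¹ x^{a-1}(1-x)^{b-1} dx. -/
noncomputable def betaFn (a b : ℝ) : ℝ := ∫ x in (0:ℝ)..1, x ^ (a - 1) * (1 - x) ^ (b - 1)

open MeasureTheory Set intervalIntegral

/-- The integrand of the generalized inverse sine with parameters `(2, q)`. -/
noncomputable def arcsinIntegrand (q t : ℝ) : ℝ := (1 - t ^ q) ^ (-(1 / 2 : ℝ))

/-- The generalized inverse sine with parameters `(2, q)`. -/
noncomputable def genArcsin (q y : ℝ) : ℝ := ∫ t in (0:ℝ)..y, arcsinIntegrand q t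

/-- The right-hand side of the first-order equation `s' = √(1 - |s| ^ q)` of the generalized
sine with parameters `(2, q)`. -/
noncomputable def sineSpeed (q y : ℝ) : ℝ := √(1 - |y| ^ q)

section Constants

variable {q : ℝ}

lemma continuous_sineSpeed (hq : 1 < q) : Continuous (sineSpeed q) := by
  unfold sineSpeed
  have := continuous_abs.rpow_const (p := q) fun _ => Or.inr (by linarith)
  fun_prop

lemma sineSpeed_sq (hq : 1 < q) {y : ℝ} (hy : |y| ≤ 1) : sineSpeed q y ^ 2 = 1 - |y| ^ q :=
  Real.sq_sqrt (sub_nonneg.2 (Real.rpow_le_one (abs_nonneg y) hy (by linarith)))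

lemma sineSpeed_zero (hq : 1 < q) : sineSpeed q 0 = 1 := by
  simp [sineSpeed, Real.zero_rpow (by linarith : q ≠ 0)]

lemma sineSpeed_one : sineSpeed q 1 = 0 := by simp [sineSpeed]

lemma rpow_lt_one_of_mem_Ico (hq : 1 < q) {y : ℝ} (hy : y ∈ Ico (0:ℝ) 1) : y ^ q < 1 :=
  Real.rpow_lt_one hy.1 hy.2 (by linarith)

lemma arcsinIntegrand_eq_inv (hq : 1 < q) {y : ℝ} (hy : y ∈ Icc (0:ℝ) 1) :
    arcsinIntegrand q y = (sineSpeed q y)⁻¹ := by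
  have h : 0 ≤ 1 - y ^ q := sub_nonneg.2 (Real.rpow_le_one hy.1 hy.2 (by linarith))
  rw [arcsinIntegrand, sineSpeed, abs_of_nonneg hy.1, Real.rpow_neg h, Real.sqrt_eq_rpow]

lemma sineSpeed_pos (hq : 1 < q) {y : ℝ} (hy : y ∈ Ico (0:ℝ) 1) : 0 < sineSpeed q y := by
  rw [sineSpeed, abs_of_nonneg hy.1]
  exact Real.sqrt_pos.2 (sub_pos.2 (rpow_lt_one_of_mem_Ico hq hy))

lemma one_le_arcsinIntegrand (hq : 1 < q) {y : ℝ} (hy : y ∈ Ico (0:ℝ) 1) :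
    1 ≤ arcsinIntegrand q y := by
  rw [arcsinIntegrand_eq_inv hq (Ico_subset_Icc_self hy)]
  refine (one_le_inv₀ (sineSpeed_pos hq hy)).2 ?_
  refine Real.sqrt_le_one.2 ?_
  linarith [Real.rpow_nonneg (abs_nonneg y) q]

lemma intervalIntegrable_arcsinIntegrand (hq : 1 < q) :
    IntervalIntegrable (arcsinIntegrand q) volume 0 1 := by
  have h1 : IntervalIntegrable (fun x : ℝ => (1 - x) ^ (-(1 / 2 : ℝ))) volume 0 1 := by
    have := (intervalIntegrable_rpow' (a := 1) (b := 0) (r := -(1 / 2)) (by norm_num)).comp_sub_left 1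
    simpa using this
  refine h1.mono_fun (Measurable.aestronglyMeasurable (by unfold arcsinIntegrand; fun_prop)) ?_
  rw [Filter.EventuallyLE, ae_restrict_iff' measurableSet_uIoc]
  refine .of_forall fun x hx => ?_
  rw [uIoc_of_le zero_le_one] at hx
  rcases hx.2.lt_or_eq with h | rfl
  · have h2 : x ^ q ≤ x := by
      simpa using Real.rpow_le_rpow_of_exponent_ge hx.1 hx.2 hq.le
    have h3 : 0 < 1 - x ^ q := by linarith
    rw [arcsinIntegrand, Real.norm_of_nonneg (Real.rpow_nonneg h3.le _),
      Real.norm_of_nonneg (Real.rpow_nonneg (by linarith) _)]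
    exact Real.rpow_le_rpow_of_nonpos (by linarith) (by linarith) (by norm_num)
  · simp [arcsinIntegrand]

lemma intervalIntegrable_arcsinIntegrand_of_mem (hq : 1 < q) {a b : ℝ} (ha : a ∈ Icc (0:ℝ) 1)
    (hb : b ∈ Icc (0:ℝ) 1) : IntervalIntegrable (arcsinIntegrand q) volume a b :=
  (intervalIntegrable_arcsinIntegrand hq).mono_set
    (by rw [uIcc_of_le zero_le_one]; exact uIcc_subset_Icc ha hb)

lemma hasDerivAt_sineSpeed (hq : 1 < q) {y : ℝ} (hy : y ∈ Ioo (0:ℝ) 1) :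
    HasDerivAt (sineSpeed q) (-(q / 2) * y ^ (q - 1) * (sineSpeed q y)⁻¹) y := by
  have h1 : HasDerivAt (fun y : ℝ => 1 - y ^ q) (-(q * y ^ (q - 1))) y :=
    (Real.hasDerivAt_rpow_const (Or.inl hy.1.ne')).const_sub 1
  have h2 := h1.sqrt (sub_pos.2 (rpow_lt_one_of_mem_Ico hq (Ioo_subset_Ico_self hy))).ne'
  have h3 : sineSpeed q =ᶠ[nhds y] fun y => √(1 - y ^ q) := by
    filter_upwards [Ioi_mem_nhds hy.1] with z hz
    rw [sineSpeed, abs_of_pos hz]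
  refine (h2.congr_of_eventuallyEq h3).congr_deriv ?_
  rw [h3.self_of_nhds]
  field_simp

lemma continuousOn_arcsinIntegrand (hq : 1 < q) : ContinuousOn (arcsinIntegrand q) (Ico 0 1) := by
  refine ContinuousOn.congr (f := fun y => (sineSpeed q y)⁻¹) ?_
    fun y hy => arcsinIntegrand_eq_inv hq (Ico_subset_Icc_self hy)
  exact (continuous_sineSpeed hq).continuousOn.inv₀ fun y hy => (sineSpeed_pos hq hy).ne'

lemma intervalIntegrable_rpow_mul_arcsinIntegrand (hq : 1 < q) :
    IntervalIntegrable (fun y => y ^ q * arcsinIntegrand q y) volume 0 1 :=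
  (intervalIntegrable_arcsinIntegrand hq).continuousOn_mul
    (Real.continuous_rpow_const (by linarith)).continuousOn

lemma integral_rpow_mul_arcsinIntegrand (hq : 1 < q) :
    ∫ y in (0:ℝ)..1, y ^ q * arcsinIntegrand q y = betaFn (1 / 2) ((q + 1) / q) / q := by
  have hq0 : q ≠ 0 := by linarith
  have hc : Continuous fun y : ℝ => y ^ q := Real.continuous_rpow_const (by linarith)
  have himg : (fun y : ℝ => 1 - y ^ q) '' uIcc 0 1 ⊆ Icc 0 1 := by
    rintro _ ⟨y, hy, rfl⟩
    rw [uIcc_of_le zero_le_one] at hy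
    have := Real.rpow_le_one hy.1 hy.2 (by linarith : 0 ≤ q)
    have := Real.rpow_nonneg hy.1 q
    constructor <;> simp only <;> linarith
  have heq : ∀ y ∈ uIcc (0:ℝ) 1,
      ((fun x : ℝ => x ^ ((1 / 2 : ℝ) - 1) * (1 - x) ^ ((q + 1) / q - 1)) ∘
        fun y : ℝ => 1 - y ^ q) y * (-(q * y ^ (q - 1)))
      = -q * (y ^ q * arcsinIntegrand q y) := by
    intro y hy
    rw [uIcc_of_le zero_le_one] at hy
    have e1 : (q + 1) / q - 1 = q⁻¹ := by field_simp; ring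
    have e2 : y * y ^ (q - 1) = y ^ q := by
      rcases hy.1.eq_or_lt with h | h
      · simp [← h, Real.zero_rpow hq0]
      · rw [Real.rpow_sub_one h.ne']; field_simp
    have e3 : (1 / 2 : ℝ) - 1 = -(1 / 2) := by norm_num
    simp only [Function.comp, e1, e3, sub_sub_cancel, Real.rpow_rpow_inv hy.1 hq0, arcsinIntegrand]
    rw [← e2]
    ring
  have hg : IntegrableOn (fun x : ℝ => x ^ ((1 / 2 : ℝ) - 1) * (1 - x) ^ ((q + 1) / q - 1))
      (Icc 0 1) := by
    rw [integrableOn_Icc_iff_integrableOn_Ioc,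
      ← intervalIntegrable_iff_integrableOn_Ioc_of_le zero_le_one]
    refine (intervalIntegrable_rpow' (by norm_num)).mul_continuousOn ?_
    have : 0 ≤ (q + 1) / q - 1 := by
      rw [sub_nonneg, one_le_div (by linarith)]
      linarith
    exact ((continuous_const.sub continuous_id).rpow_const fun _ => Or.inr this).continuousOn
  have h := intervalIntegral.integral_comp_mul_deriv''' (a := 0) (b := 1)
    (f := fun y : ℝ => 1 - y ^ q) (f' := fun y => -(q * y ^ (q - 1)))
    (g := fun x : ℝ => x ^ ((1 / 2 : ℝ) - 1) * (1 - x) ^ ((q + 1) / q - 1))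
    (by fun_prop) ?_ ?_ (hg.mono_set himg) ?_
  · rw [intervalIntegral.integral_congr heq, intervalIntegral.integral_const_mul] at h
    simp only [Real.zero_rpow hq0, Real.one_rpow, sub_zero, sub_self] at h
    rw [intervalIntegral.integral_symm 0 1] at h
    rw [betaFn, eq_div_iff hq0]
    linarith
  · intro x hx
    simp only [min_eq_left zero_le_one, max_eq_right zero_le_one] at hx
    exact ((Real.hasDerivAt_rpow_const (Or.inl hx.1.ne')).const_sub 1).hasDerivWithinAt
  · rintro _ ⟨y, hy, rfl⟩
    simp only [min_eq_left (zero_le_one' ℝ), max_eq_right (zero_le_one' ℝ)] at hy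
    have h1 := rpow_lt_one_of_mem_Ico hq (Ioo_subset_Ico_self hy)
    have h2 := Real.rpow_pos_of_pos hy.1 q
    refine ContinuousAt.continuousWithinAt ?_
    refine (Real.continuousAt_rpow_const _ _ (Or.inl (by simp only; linarith))).mul ?_
    exact ContinuousAt.rpow_const (by fun_prop) (Or.inl (by simp only; linarith))
  · refine IntegrableOn.congr_fun ?_ (fun y hy => (heq y hy).symm) measurableSet_uIcc
    rw [uIcc_of_le zero_le_one, integrableOn_Icc_iff_integrableOn_Ioc,
      ← intervalIntegrable_iff_integrableOn_Ioc_of_le zero_le_one]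
    exact (intervalIntegrable_rpow_mul_arcsinIntegrand hq).const_mul _

lemma integral_sineSpeed_eq_sub (hq : 1 < q) :
    ∫ y in (0:ℝ)..1, sineSpeed q y =
      genArcsin q 1 - ∫ y in (0:ℝ)..1, y ^ q * arcsinIntegrand q y := by
  rw [genArcsin, ← intervalIntegral.integral_sub (intervalIntegrable_arcsinIntegrand hq)
    (intervalIntegrable_rpow_mul_arcsinIntegrand hq)]
  refine intervalIntegral.integral_congr fun y hy => ?_
  rw [uIcc_of_le zero_le_one] at hy
  have h := sineSpeed_sq hq (y := y) (by rw [abs_of_nonneg hy.1]; exact hy.2)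
  rw [abs_of_nonneg hy.1] at h
  rw [arcsinIntegrand_eq_inv hq hy, ← one_sub_mul, ← h]
  by_cases h0 : sineSpeed q y = 0
  · simp [h0]
  · field_simp

lemma integral_sineSpeed_eq_mul (hq : 1 < q) :
    ∫ y in (0:ℝ)..1, sineSpeed q y =
      q / 2 * ∫ y in (0:ℝ)..1, y ^ q * arcsinIntegrand q y := by
  have hi : IntervalIntegrable (sineSpeed q) volume 0 1 :=
    (continuous_sineSpeed hq).intervalIntegrable _ _
  have hj := (intervalIntegrable_rpow_mul_arcsinIntegrand hq).const_mul (q / 2)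
  have h := intervalIntegral.integral_eq_sub_of_hasDerivAt_of_le zero_le_one
    (f := fun y => y * sineSpeed q y)
    (f' := fun y => sineSpeed q y - q / 2 * (y ^ q * arcsinIntegrand q y))
    (continuous_id.mul (continuous_sineSpeed hq)).continuousOn ?_ (hi.sub hj)
  · rw [intervalIntegral.integral_sub hi hj, intervalIntegral.integral_const_mul] at h
    simp only [sineSpeed_one] at h
    linarith
  · intro y hy
    refine ((hasDerivAt_id y).mul (hasDerivAt_sineSpeed hq hy)).congr_deriv ?_
    rw [arcsinIntegrand_eq_inv hq (Ioo_subset_Icc_self hy), Real.rpow_sub_one hy.1.ne']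
    have := hy.1.ne'
    simp only [id]
    field_simp
    ring

lemma two_mul_integral_sineSpeed (hq : 1 < q) :
    2 * ∫ y in (0:ℝ)..1, sineSpeed q y = betaFn (1 / 2) ((q + 1) / q) := by
  have hq0 : q ≠ 0 := by linarith
  rw [integral_sineSpeed_eq_mul hq, integral_rpow_mul_arcsinIntegrand hq]
  field_simp

lemma two_mul_genArcsin_one (hq : 1 < q) :
    2 * genArcsin q 1 = (1 + 2 / q) * betaFn (1 / 2) ((q + 1) / q) := by
  have h1 := two_mul_integral_sineSpeed hq
  have h2 := integral_sineSpeed_eq_sub hq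
  have h3 := integral_rpow_mul_arcsinIntegrand hq
  rw [h3] at h2
  rw [← h1] at h2 ⊢
  linear_combination -2 * h2

lemma betaFn_pos (hq : 1 < q) : 0 < betaFn (1 / 2) ((q + 1) / q) := by
  rw [← two_mul_integral_sineSpeed hq]
  refine mul_pos two_pos ?_
  refine intervalIntegral_pos_of_pos_on ((continuous_sineSpeed hq).intervalIntegrable _ _)
    (fun y hy => sineSpeed_pos hq (Ioo_subset_Ico_self hy)) one_pos

end Constants

section FirstOrder

variable {q : ℝ}

lemma integral_deriv_sub_mul_sineSpeed_sq (hq : 1 < q) {g : ℝ → ℝ} (hg : ContDiff ℝ 1 g)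
    {x y : ℝ} (hxy : x ≤ y) (hb : ∀ t ∈ Icc x y, |g t| ≤ 1) (c : ℝ) :
    ∫ t in x..y, (deriv g t - c * sineSpeed q (g t)) ^ 2 =
      (∫ t in x..y, deriv g t ^ 2) - 2 * c * (∫ s in g x..g y, sineSpeed q s)
        + c ^ 2 * ((y - x) - ∫ t in x..y, |g t| ^ q) := by
  have hd : Continuous (deriv g) := hg.continuous_deriv_one
  have hw := continuous_sineSpeed hq
  have hgc := hg.continuous
  have habs : Continuous fun t => |g t| ^ q :=
    hgc.abs.rpow_const fun _ => Or.inr (by linarith)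
  have h1 : ∫ t in x..y, sineSpeed q (g t) * deriv g t = ∫ s in g x..g y, sineSpeed q s :=
    intervalIntegral.integral_comp_mul_deriv
      (fun t _ => (hg.differentiable one_ne_zero t).hasDerivAt) hd.continuousOn hw
  have h2 : ∫ t in x..y, (1 - |g t| ^ q) = (y - x) - ∫ t in x..y, |g t| ^ q := by
    rw [intervalIntegral.integral_sub (by simp) (habs.intervalIntegrable _ _)]
    simp
  rw [← h1, ← h2, ← intervalIntegral.integral_const_mul, ← intervalIntegral.integral_const_mul,
    ← intervalIntegral.integral_sub, ← intervalIntegral.integral_add]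
  · refine intervalIntegral.integral_congr fun t ht => ?_
    rw [uIcc_of_le hxy] at ht
    rw [← sineSpeed_sq hq (hb t ht)]
    ring
  all_goals exact Continuous.intervalIntegrable (by fun_prop) _ _

lemma integral_deriv_sub_sq_add_integral_deriv_add_sq (hq : 1 < q) {g : ℝ → ℝ}
    (hg : ContDiff ℝ 1 g) {b t₀ : ℝ} (h0 : g 0 = 0) (hb : g b = 0) (ht₀ : t₀ ∈ Icc 0 b)
    (h1 : g t₀ = 1) (hle : ∀ t ∈ Icc 0 b, |g t| ≤ 1) (c : ℝ) :
    (∫ t in (0:ℝ)..t₀, (deriv g t - c * sineSpeed q (g t)) ^ 2) +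
      ∫ t in t₀..b, (deriv g t + c * sineSpeed q (g t)) ^ 2 =
    (∫ t in (0:ℝ)..b, deriv g t ^ 2) - 2 * c * betaFn (1 / 2) ((q + 1) / q)
      + c ^ 2 * (b - ∫ t in (0:ℝ)..b, |g t| ^ q) := by
  have hd : Continuous fun t => deriv g t ^ 2 := hg.continuous_deriv_one.pow 2
  have habs : Continuous fun t => |g t| ^ q :=
    hg.continuous.abs.rpow_const fun _ => Or.inr (by linarith)
  have e1 := integral_deriv_sub_mul_sineSpeed_sq hq hg ht₀.1
    (fun t ht => hle t ⟨ht.1, ht.2.trans ht₀.2⟩) c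
  have e2 := integral_deriv_sub_mul_sineSpeed_sq hq hg ht₀.2
    (fun t ht => hle t ⟨ht₀.1.trans ht.1, ht.2⟩) (-c)
  simp only [neg_mul, sub_neg_eq_add] at e2
  rw [h0, h1] at e1
  rw [hb, h1, intervalIntegral.integral_symm 0 1] at e2
  rw [e1, e2, ← two_mul_integral_sineSpeed hq,
    ← intervalIntegral.integral_add_adjacent_intervals (b := t₀)
      (hd.intervalIntegrable 0 t₀) (hd.intervalIntegrable t₀ b),
    ← intervalIntegral.integral_add_adjacent_intervals (b := t₀)
      (habs.intervalIntegrable 0 t₀) (habs.intervalIntegrable t₀ b)]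
  ring

lemma sharp_bound_of_sq_le (hq : 1 < q) {B N E : ℝ} (hB : 0 < B) (hN : 0 < N) (hE : 0 ≤ E)
    (h : B ^ 2 ≤ E * ((1 + 2 / q) * B - N)) :
    B ≤ E * (2 / q * B / N) ^ (2 / q) ∧
      (B = E * (2 / q * B / N) ^ (2 / q) → N = 2 / q * B ∧ E = B) := by
  have hr : 0 < 2 / q := by positivity
  set r := 2 / q with hr_def
  set x := r * B / N with hx
  have hx0 : 0 < x := by positivity
  have hxN : x * N = r * B := by rw [hx]; field_simp
  have hE0 : 0 < E := by
    refine hE.lt_of_ne fun h0 => ?_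
    rw [← h0, zero_mul] at h
    nlinarith
  have hpow : x ^ (1 + r) = x * x ^ r := by rw [Real.rpow_add hx0, Real.rpow_one]
  have key : r * (B * x ^ r) = N * (x * x ^ r) := by linear_combination -(x ^ r) * hxN
  have key2 : r * ((1 + r) * B - N) = N * (1 + (1 + r) * (x - 1)) := by
    linear_combination -(1 + r) * hxN
  by_cases hx1 : x = 1
  · have hNB : N = r * B := by rw [← hxN, hx1, one_mul]
    have hEB : B ≤ E := by
      have : (1 + r) * B - N = B := by rw [hNB]; ring
      rw [this] at h
      nlinarith
    rw [hx1, Real.one_rpow, mul_one]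
    exact ⟨hEB, fun h' => ⟨hNB, h'.symm⟩⟩
  · have hbern := one_add_mul_self_lt_rpow_one_add (s := x - 1) (by linarith)
      (sub_ne_zero.2 hx1) (p := 1 + r) (by linarith)
    rw [add_sub_cancel, hpow] at hbern
    have h1 : (1 + r) * B - N < B * x ^ r := by
      refine lt_of_mul_lt_mul_left ?_ hr.le
      rw [key, key2]
      exact mul_lt_mul_of_pos_left hbern hN
    have h2 : B < E * x ^ r := by
      refine lt_of_mul_lt_mul_left ?_ hB.le
      nlinarith
    exact ⟨h2.le, fun h' => absurd h' h2.ne⟩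

lemma eq_zero_of_integral_sq_eq_zero {φ : ℝ → ℝ} (hφ : Continuous φ) {a b : ℝ} (hab : a < b)
    (h : ∫ t in a..b, φ t ^ 2 = 0) {t : ℝ} (ht : t ∈ Icc a b) : φ t = 0 := by
  by_contra h0
  exact (intervalIntegral.integral_pos hab (hφ.pow 2).continuousOn (fun x _ => sq_nonneg _)
    ⟨t, ht, (sq_nonneg _).lt_of_ne' (pow_ne_zero 2 h0)⟩).ne' h

/-- Sharp first-order inequality for functions normalised by their maximum modulus. -/
lemma sharp_energy_bound (hq : 1 < q) {g : ℝ → ℝ}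
    (hg : ContDiff ℝ 1 g) {b t₀ : ℝ} (hbq : b = (1 + 2 / q) * betaFn (1 / 2) ((q + 1) / q))
    (h0 : g 0 = 0) (hb : g b = 0) (ht₀ : t₀ ∈ Icc 0 b)
    (h1 : g t₀ = 1) (hle : ∀ t ∈ Icc 0 b, |g t| ≤ 1) :
    betaFn (1 / 2) ((q + 1) / q) ≤ (∫ t in (0:ℝ)..b, deriv g t ^ 2) *
        (2 / q * betaFn (1 / 2) ((q + 1) / q) / ∫ t in (0:ℝ)..b, |g t| ^ q) ^ (2 / q) ∧
      (betaFn (1 / 2) ((q + 1) / q) = (∫ t in (0:ℝ)..b, deriv g t ^ 2) *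
        (2 / q * betaFn (1 / 2) ((q + 1) / q) / ∫ t in (0:ℝ)..b, |g t| ^ q) ^ (2 / q) →
        (∀ t ∈ Icc 0 t₀, deriv g t = sineSpeed q (g t)) ∧
        ∀ t ∈ Icc t₀ b, deriv g t = -sineSpeed q (g t)) := by
  have hB := betaFn_pos hq
  have hcal := integral_deriv_sub_sq_add_integral_deriv_add_sq hq hg h0 hb ht₀ h1 hle
  have ht0 : 0 < t₀ := ht₀.1.lt_of_ne fun h => by rw [← h, h0] at h1; norm_num at h1
  have htb : t₀ < b := ht₀.2.lt_of_ne fun h => by rw [h, hb] at h1; norm_num at h1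
  have hnn1 : ∀ φ : ℝ → ℝ, 0 ≤ ∫ t in (0:ℝ)..t₀, φ t ^ 2 := fun φ =>
    intervalIntegral.integral_nonneg ht0.le fun t _ => sq_nonneg _
  have hnn2 : ∀ φ : ℝ → ℝ, 0 ≤ ∫ t in t₀..b, φ t ^ 2 := fun φ =>
    intervalIntegral.integral_nonneg htb.le fun t _ => sq_nonneg _
  have habs : Continuous fun t => |g t| ^ q :=
    hg.continuous.abs.rpow_const fun _ => Or.inr (by linarith)
  have hN : 0 < ∫ t in (0:ℝ)..b, |g t| ^ q :=
    intervalIntegral.integral_pos (ht0.trans htb) habs.continuousOn (fun t _ => by positivity)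
      ⟨t₀, ht₀, by simp [h1]⟩
  have hE : 0 ≤ ∫ t in (0:ℝ)..b, deriv g t ^ 2 :=
    intervalIntegral.integral_nonneg (ht0.trans htb).le fun t _ => sq_nonneg _
  set B := betaFn (1 / 2) ((q + 1) / q)
  set N := ∫ t in (0:ℝ)..b, |g t| ^ q
  set E := ∫ t in (0:ℝ)..b, deriv g t ^ 2
  have hdisc := discrim_le_zero (a := b - N) (b := -2 * B) (c := E) fun c => by
    have := add_nonneg (hnn1 fun t => deriv g t - c * sineSpeed q (g t))
      (hnn2 fun t => deriv g t + c * sineSpeed q (g t))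
    rw [hcal c] at this
    linarith
  have hsq : B ^ 2 ≤ E * ((1 + 2 / q) * B - N) := by
    rw [← hbq]
    unfold discrim at hdisc
    nlinarith
  obtain ⟨hle', heq⟩ := sharp_bound_of_sq_le hq hB hN hE hsq
  refine ⟨hle', fun h => ?_⟩
  obtain ⟨hNB, hEB⟩ := heq h
  have hz := hcal 1
  have hz' : E - 2 * 1 * B + 1 ^ 2 * (b - N) = 0 := by rw [hbq, hNB, hEB]; ring
  rw [hz'] at hz
  simp only [one_mul] at hz
  have hn1 := hnn1 fun t => deriv g t - sineSpeed q (g t)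
  have hn2 := hnn2 fun t => deriv g t + sineSpeed q (g t)
  have hd : Continuous (deriv g) := hg.continuous_deriv_one
  have hw := (continuous_sineSpeed hq).comp hg.continuous
  exact ⟨fun t ht => sub_eq_zero.1
      (eq_zero_of_integral_sq_eq_zero (hd.sub hw) ht0 (by simpa using by linarith) ht),
    fun t ht => eq_neg_of_add_eq_zero_left
      (eq_zero_of_integral_sq_eq_zero (hd.add hw) htb (by simpa using by linarith) ht)⟩

end FirstOrder

section GenArcsin

variable {q : ℝ}

lemma genArcsin_zero : genArcsin q 0 = 0 := by simp [genArcsin]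

lemma continuousOn_genArcsin (hq : 1 < q) : ContinuousOn (genArcsin q) (Icc 0 1) := by
  have := intervalIntegral.continuousOn_primitive_interval' (a := 0)
    (intervalIntegrable_arcsinIntegrand hq) left_mem_uIcc
  rwa [uIcc_of_le zero_le_one] at this

lemma hasDerivAt_genArcsin (hq : 1 < q) {y : ℝ} (hy : y ∈ Ioo (0:ℝ) 1) :
    HasDerivAt (genArcsin q) (sineSpeed q y)⁻¹ y := by
  rw [← arcsinIntegrand_eq_inv hq (Ioo_subset_Icc_self hy)]
  refine intervalIntegral.integral_hasDerivAt_right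
    (intervalIntegrable_arcsinIntegrand_of_mem hq (left_mem_Icc.2 zero_le_one)
      (Ioo_subset_Icc_self hy)) ?_
    ((continuousOn_arcsinIntegrand hq).continuousAt (Ico_mem_nhds hy.1 hy.2))
  exact ((continuousOn_arcsinIntegrand hq).mono Ioo_subset_Ico_self).stronglyMeasurableAtFilter
    isOpen_Ioo y hy

lemma sub_le_genArcsin_sub (hq : 1 < q) {x y : ℝ} (hx : x ∈ Icc (0:ℝ) 1) (hy : y ∈ Icc (0:ℝ) 1)
    (hxy : x ≤ y) : y - x ≤ genArcsin q y - genArcsin q x := by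
  have h0 := left_mem_Icc.2 (zero_le_one' ℝ)
  rw [genArcsin, genArcsin, intervalIntegral.integral_interval_sub_left
    (intervalIntegrable_arcsinIntegrand_of_mem hq h0 hy)
    (intervalIntegrable_arcsinIntegrand_of_mem hq h0 hx)]
  have h := intervalIntegral.integral_mono_on_of_le_Ioo hxy (f := fun _ => (1:ℝ)) (by simp)
    (intervalIntegrable_arcsinIntegrand_of_mem hq hx hy)
    fun t ht => one_le_arcsinIntegrand hq ⟨hx.1.trans ht.1.le, ht.2.trans_le hy.2⟩
  simpa using h

lemma exists_genArcsin_eq (hq : 1 < q) {t : ℝ} (ht : t ∈ Icc 0 (genArcsin q 1)) :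
    ∃ y ∈ Icc (0:ℝ) 1, genArcsin q y = t := by
  rw [← genArcsin_zero (q := q)] at ht
  exact intermediate_value_Icc zero_le_one (continuousOn_genArcsin hq) ht

/-- A solution of `g' = √(1 - |g| ^ q)` which climbs from `0` to `1` inverts `genArcsin`. -/
lemma apply_genArcsin_of_deriv_eq (hq : 1 < q) {g : ℝ → ℝ} (hg : ContDiff ℝ 1 g) {t₀ : ℝ}
    (ht₀ : 0 ≤ t₀) (h0 : g 0 = 0) (h1 : g t₀ = 1) (hle : ∀ t ∈ Icc 0 t₀, |g t| ≤ 1)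
    (hode : ∀ t ∈ Icc 0 t₀, deriv g t = sineSpeed q (g t)) {y : ℝ} (hy : y ∈ Icc (0:ℝ) 1) :
    g (genArcsin q y) = y := by
  have hgc := hg.continuous
  have hgd := hg.differentiable one_ne_zero
  have hmono : MonotoneOn g (Icc 0 t₀) := by
    refine monotoneOn_of_deriv_nonneg (convex_Icc _ _) hgc.continuousOn hgd.differentiableOn
      fun t ht => ?_
    rw [hode t (interior_subset ht)]
    exact Real.sqrt_nonneg _
  obtain ⟨t₁, ⟨ht₁, hgt₁⟩, hleast⟩ :=
    (isCompact_Icc.inter_right (isClosed_singleton.preimage hgc)).exists_isLeast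
      (⟨t₀, right_mem_Icc.2 ht₀, h1⟩ : (Icc 0 t₀ ∩ g ⁻¹' {1}).Nonempty)
  have hsub : ∀ {t}, t ∈ Icc 0 t₁ → t ∈ Icc 0 t₀ := fun ht => ⟨ht.1, ht.2.trans ht₁.2⟩
  have hmem : ∀ t ∈ Icc 0 t₁, g t ∈ Icc (0:ℝ) 1 := fun t ht =>
    ⟨h0 ▸ hmono (left_mem_Icc.2 ht₀) (hsub ht) ht.1, (abs_le.1 (hle t (hsub ht))).2⟩
  have hlt : ∀ t ∈ Ico 0 t₁, g t < 1 := fun t ht =>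
    (hmem t (Ico_subset_Icc_self ht)).2.lt_of_ne fun h =>
      (hleast ⟨hsub (Ico_subset_Icc_self ht), h⟩).not_gt ht.2
  have hstrict : StrictMonoOn g (Icc 0 t₁) := by
    refine strictMonoOn_of_deriv_pos (convex_Icc _ _) hgc.continuousOn fun t ht => ?_
    rw [interior_Icc] at ht
    rw [hode t (hsub (Ioo_subset_Icc_self ht))]
    exact sineSpeed_pos hq ⟨(hmem t (Ioo_subset_Icc_self ht)).1, hlt t (Ioo_subset_Ico_self ht)⟩
  have hinv : ∀ t ∈ Icc 0 t₁, genArcsin q (g t) = t := by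
    intro t ht
    have h := intervalIntegral.integral_eq_sub_of_hasDerivAt_of_le ht.1
      (f := fun t => genArcsin q (g t)) (f' := fun _ => 1)
      ((continuousOn_genArcsin hq).comp hgc.continuousOn
        fun s hs => hmem s ⟨hs.1, hs.2.trans ht.2⟩) ?_ (by simp)
    · simpa [h0, genArcsin_zero] using h.symm
    · intro s hs
      have hs' : s ∈ Ico 0 t₁ := ⟨hs.1.le, hs.2.trans_le ht.2⟩
      have hpos : 0 < g s := h0 ▸ hstrict (left_mem_Icc.2 (ht.1.trans ht.2))
        (Ico_subset_Icc_self hs') hs.1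
      have hd := (hgd s).hasDerivAt
      rw [hode s (hsub (Ico_subset_Icc_self hs'))] at hd
      refine ((hasDerivAt_genArcsin hq ⟨hpos, hlt s hs'⟩).comp s hd).congr_deriv ?_
      exact inv_mul_cancel₀ (sineSpeed_pos hq ⟨hpos.le, hlt s hs'⟩).ne'
  obtain ⟨t, ht, rfl⟩ : ∃ t ∈ Icc 0 t₁, g t = y := by
    refine intermediate_value_Icc ht₁.1 hgc.continuousOn ?_
    rwa [h0, show g t₁ = 1 from hgt₁]
  rw [hinv t ht]

end GenArcsin

section GenSine

variable {q b : ℝ} {sn : ℝ → ℝ}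

lemma genArcsin_one_pos (hq : 1 < q) : 0 < genArcsin q 1 := by
  linarith [sub_le_genArcsin_sub hq (left_mem_Icc.2 zero_le_one) (right_mem_Icc.2 zero_le_one)
    zero_le_one, genArcsin_zero (q := q)]

lemma genSine_mem_Icc (hq : 1 < q) (hb : b = 2 * genArcsin q 1)
    (hinv : ∀ y ∈ Icc (0:ℝ) 1, sn (genArcsin q y) = y) (hsym : ∀ x, sn (b - x) = sn x)
    {t : ℝ} (ht : t ∈ Icc 0 b) : sn t ∈ Icc (0:ℝ) 1 := by
  wlog h : t ≤ genArcsin q 1 generalizing t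
  · rw [← hsym]
    exact this ⟨by linarith [ht.2], by linarith [ht.1]⟩ (by linarith)
  · obtain ⟨y, hy, rfl⟩ := exists_genArcsin_eq hq ⟨ht.1, h⟩
    rwa [hinv y hy]

lemma continuousOn_of_left_half (hb : 0 ≤ b) {f : ℝ → ℝ}
    (h1 : ContinuousOn f (Icc 0 (b / 2))) (h2 : ContinuousOn f (Icc (b / 2) b)) :
    ContinuousOn f (Icc 0 b) := by
  rw [← Icc_union_Icc_eq_Icc (by linarith : 0 ≤ b / 2) (by linarith : b / 2 ≤ b)]
  exact h1.union_of_isClosed h2 isClosed_Icc isClosed_Icc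

lemma continuousOn_genSine (hq : 1 < q) (hb : b = 2 * genArcsin q 1)
    (hinv : ∀ y ∈ Icc (0:ℝ) 1, sn (genArcsin q y) = y) (hsym : ∀ x, sn (b - x) = sn x) :
    ContinuousOn sn (Icc 0 b) := by
  have hT : b / 2 = genArcsin q 1 := by linarith
  have hlip : ContinuousOn sn (Icc 0 (b / 2)) := by
    rw [hT]
    refine (LipschitzOnWith.of_dist_le_mul (K := 1) fun s hs t ht => ?_).continuousOn
    obtain ⟨x, hx, rfl⟩ := exists_genArcsin_eq hq hs
    obtain ⟨y, hy, rfl⟩ := exists_genArcsin_eq hq ht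
    rw [hinv x hx, hinv y hy, NNReal.coe_one, one_mul]
    rcases le_total x y with h | h
    · rw [dist_comm, dist_comm (genArcsin q x), Real.dist_eq, Real.dist_eq]
      exact abs_le_abs_of_nonneg (by linarith) (sub_le_genArcsin_sub hq hx hy h)
    · rw [Real.dist_eq, Real.dist_eq]
      exact abs_le_abs_of_nonneg (by linarith) (sub_le_genArcsin_sub hq hy hx h)
  refine continuousOn_of_left_half (by linarith [genArcsin_one_pos hq]) hlip ?_
  have h := hlip.comp (f := fun t => b - t) (s := Icc (b / 2) b) (by fun_prop)
    fun t ht => ⟨by linarith [ht.2], by linarith [ht.1]⟩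
  exact h.congr fun t _ => (hsym t).symm

lemma hasDerivAt_genSine (hq : 1 < q) (hb : b = 2 * genArcsin q 1)
    (hinv : ∀ y ∈ Icc (0:ℝ) 1, sn (genArcsin q y) = y) (hsym : ∀ x, sn (b - x) = sn x)
    {t : ℝ} (ht : t ∈ Ioo 0 (b / 2)) :
    HasDerivAt sn (sineSpeed q (sn t)) t ∧
      HasDerivAt (fun t => sineSpeed q (sn t)) (-(q / 2) * sn t ^ (q - 1)) t := by
  have hT : b / 2 = genArcsin q 1 := by linarith
  have hc := continuousOn_genSine hq hb hinv hsym
  have hcat : ContinuousAt sn t := hc.continuousAt (Icc_mem_nhds ht.1 (by linarith [ht.1, ht.2]))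
  have hleft : ∀ᶠ s in nhds t, genArcsin q (sn s) = s := by
    filter_upwards [Ioo_mem_nhds ht.1 ht.2] with s hs
    obtain ⟨y, hy, rfl⟩ := exists_genArcsin_eq hq ⟨hs.1.le, hT ▸ hs.2.le⟩
    rw [hinv y hy]
  have hy : sn t ∈ Ioo (0:ℝ) 1 := by
    have hm := genSine_mem_Icc hq hb hinv hsym ⟨ht.1.le, by linarith [ht.1, ht.2]⟩
    have hs := hleft.self_of_nhds
    refine ⟨hm.1.lt_of_ne fun h => ?_, hm.2.lt_of_ne fun h => ?_⟩
    · rw [← h, genArcsin_zero] at hs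
      exact ht.1.ne hs
    · rw [h, ← hT] at hs
      exact ht.2.ne' hs
  have hw := (sineSpeed_pos hq (Ioo_subset_Ico_self hy)).ne'
  have h1 : HasDerivAt sn (sineSpeed q (sn t)) t := by
    simpa using (hasDerivAt_genArcsin hq hy).of_local_left_inverse hcat (inv_ne_zero hw) hleft
  refine ⟨h1, ((hasDerivAt_sineSpeed hq hy).comp t h1).congr_deriv ?_⟩
  field_simp

lemma hasDerivAt_genSine_right (hq : 1 < q) (hb : b = 2 * genArcsin q 1)
    (hinv : ∀ y ∈ Icc (0:ℝ) 1, sn (genArcsin q y) = y) (hsym : ∀ x, sn (b - x) = sn x)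
    {t : ℝ} (ht : t ∈ Ioo (b / 2) b) :
    HasDerivAt sn (-sineSpeed q (sn t)) t ∧
      HasDerivAt (fun t => -sineSpeed q (sn t)) (-(q / 2) * sn t ^ (q - 1)) t := by
  have h := hasDerivAt_genSine hq hb hinv hsym (t := b - t)
    ⟨by linarith [ht.2], by linarith [ht.1]⟩
  have h1 := h.1.comp t ((hasDerivAt_id t).const_sub b)
  have h2 := (h.2.comp t ((hasDerivAt_id t).const_sub b)).neg
  refine ⟨?_, ?_⟩
  · exact (h1.congr_of_eventuallyEq (.of_forall fun s => (hsym s).symm)).congr_deriv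
      (by simp [hsym])
  · exact (h2.congr_of_eventuallyEq (.of_forall fun s => by simp [hsym])).congr_deriv
      (by simp [hsym])

/-- The generalized sine on `[0, b]` extends to a `C²` function on the line. -/
lemma exists_contDiff_extension_genSine (hq : 1 < q) (hb : b = 2 * genArcsin q 1)
    (hinv : ∀ y ∈ Icc (0:ℝ) 1, sn (genArcsin q y) = y) (hsym : ∀ x, sn (b - x) = sn x) :
    ∃ S : ℝ → ℝ, ContDiff ℝ 2 S ∧ (∀ t ∈ Icc 0 b, S t = sn t) ∧
      (∀ t ∈ Icc 0 (b / 2), deriv S t = sineSpeed q (S t)) ∧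
      (∀ t ∈ Icc (b / 2) b, deriv S t = -sineSpeed q (S t)) ∧
      ∀ t ∈ Icc 0 b, deriv (deriv S) t = -(q / 2) * S t ^ (q - 1) := by
  have hT : b / 2 = genArcsin q 1 := by linarith
  have hT0 := genArcsin_one_pos hq
  have hb0 : 0 ≤ b := by linarith
  have hc := continuousOn_genSine hq hb hinv hsym
  have hsn0 : sn 0 = 0 := by simpa [genArcsin_zero] using hinv 0 (by simp)
  have hsnT : sn (b / 2) = 1 := by rw [hT]; exact hinv 1 (by simp)
  set V : ℝ → ℝ := fun t => if t ≤ b / 2 then sineSpeed q (sn t) else -sineSpeed q (sn t) with hV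
  have hV1 : ∀ t ∈ Icc 0 (b / 2), V t = sineSpeed q (sn t) := fun t ht => if_pos ht.2
  have hV2 : ∀ t ∈ Icc (b / 2) b, V t = -sineSpeed q (sn t) := by
    intro t ht
    rcases ht.1.eq_or_lt with rfl | h
    · simp [hV, hsnT, sineSpeed_one]
    · exact if_neg h.not_ge
  have hwc := (continuous_sineSpeed hq).comp_continuousOn hc
  have hVc : ContinuousOn V (Icc 0 b) := by
    refine continuousOn_of_left_half hb0 ?_ ?_
    · exact (hwc.mono (Icc_subset_Icc_right (by linarith))).congr hV1
    · exact (hwc.neg.mono (Icc_subset_Icc_left (by linarith))).congr hV2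
  have hderiv : ∀ t ∈ Ioo 0 b \ {b / 2},
      HasDerivAt sn (V t) t ∧ HasDerivAt V (-(q / 2) * sn t ^ (q - 1)) t := by
    rintro t ⟨ht, hne⟩
    rcases lt_or_gt_of_ne hne with h | h
    · have hd := hasDerivAt_genSine hq hb hinv hsym ⟨ht.1, h⟩
      rw [hV1 t ⟨ht.1.le, h.le⟩]
      refine ⟨hd.1, hd.2.congr_of_eventuallyEq ?_⟩
      filter_upwards [Ioo_mem_nhds ht.1 h] with s hs using hV1 s (Ioo_subset_Icc_self hs)
    · have hd := hasDerivAt_genSine_right hq hb hinv hsym ⟨h, ht.2⟩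
      rw [hV2 t ⟨h.le, ht.2.le⟩]
      refine ⟨hd.1, hd.2.congr_of_eventuallyEq ?_⟩
      filter_upwards [Ioo_mem_nhds h ht.2] with s hs using hV2 s (Ioo_subset_Icc_self hs)
  have hhc : ContinuousOn (fun t => -(q / 2) * sn t ^ (q - 1)) (Icc 0 b) :=
    continuousOn_const.mul (hc.rpow_const fun _ _ => Or.inr (by linarith))
  have hftc : ∀ {u v : ℝ → ℝ}, ContinuousOn u (Icc 0 b) → ContinuousOn v (Icc 0 b) →
      (∀ t ∈ Ioo 0 b \ {b / 2}, HasDerivAt u (v t) t) → ∀ t ∈ Icc 0 b,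
      ∫ s in (0:ℝ)..t, v s = u t - u 0 := by
    intro u v hu hv huv t ht
    have hsub : Icc 0 t ⊆ Icc 0 b := Icc_subset_Icc_right ht.2
    refine integral_eq_of_hasDerivAt_off_countable_of_le u v ht.1 (countable_singleton (b / 2))
      (hu.mono hsub) (fun s hs => huv s ⟨⟨hs.1.1, hs.1.2.trans_le ht.2⟩, hs.2⟩) ?_
    exact (hv.mono hsub).intervalIntegrable_of_Icc ht.1
  set H : ℝ → ℝ := IccExtend hb0 ((Icc 0 b).domRestrict fun t => -(q / 2) * sn t ^ (q - 1))
  have hHc : Continuous H := hhc.domRestrict.Icc_extend'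
  have hH : ∀ t ∈ Icc 0 b, H t = -(q / 2) * sn t ^ (q - 1) := fun t ht =>
    IccExtend_of_mem hb0 _ ht
  set S₁ : ℝ → ℝ := fun t => 1 + ∫ s in (0:ℝ)..t, H s
  have hS₁d : ∀ t, HasDerivAt S₁ (H t) t := fun t =>
    (hHc.integral_hasStrictDerivAt 0 t).hasDerivAt.const_add 1
  have hS₁c : Continuous S₁ := continuous_iff_continuousAt.2 fun t => (hS₁d t).continuousAt
  set S : ℝ → ℝ := fun t => ∫ s in (0:ℝ)..t, S₁ s
  have hSd : ∀ t, HasDerivAt S (S₁ t) t := fun t => (hS₁c.integral_hasStrictDerivAt 0 t).hasDerivAt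
  have hS₁V : ∀ t ∈ Icc 0 b, S₁ t = V t := by
    intro t ht
    have h := hftc hVc (hhc.congr hH)
      (fun t ht => by rw [hH t (Ioo_subset_Icc_self ht.1)]; exact (hderiv t ht).2) t ht
    have hV0 : V 0 = 1 := by rw [hV1 0 ⟨le_rfl, by linarith⟩, hsn0, sineSpeed_zero hq]
    simp only [S₁]
    rw [h, hV0]
    ring
  have hSsn : ∀ t ∈ Icc 0 b, S t = sn t := by
    intro t ht
    have h := hftc hc hS₁c.continuousOn
      (fun t ht => by rw [hS₁V t (Ioo_subset_Icc_self ht.1)]; exact (hderiv t ht).1) t ht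
    rwa [hsn0, sub_zero] at h
  have e1 : deriv S = S₁ := funext fun t => (hSd t).deriv
  have e2 : deriv S₁ = H := funext fun t => (hS₁d t).deriv
  refine ⟨S, ?_, hSsn, fun t ht => ?_, fun t ht => ?_, fun t ht => ?_⟩
  · rw [show (2 : WithTop ℕ∞) = 1 + 1 by norm_num, contDiff_succ_iff_deriv, e1,
      contDiff_one_iff_deriv, e2]
    exact ⟨fun t => (hSd t).differentiableAt, by simp, fun t => (hS₁d t).differentiableAt, hHc⟩
  · have ht' : t ∈ Icc 0 b := ⟨ht.1, by linarith [ht.2]⟩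
    rw [e1, hS₁V t ht', hSsn t ht', hV1 t ht]
  · have ht' : t ∈ Icc 0 b := ⟨by linarith [ht.1], ht.2⟩
    rw [e1, hS₁V t ht', hSsn t ht', hV2 t ht]
  · rw [e1, e2, hH t ht, hSsn t ht]

lemma eqOn_genSine_of_deriv_eq (hq : 1 < q) (hb : b = 2 * genArcsin q 1)
    (hinv : ∀ y ∈ Icc (0:ℝ) 1, sn (genArcsin q y) = y) (hsym : ∀ x, sn (b - x) = sn x)
    {g : ℝ → ℝ} (hg : ContDiff ℝ 1 g) {t₀ : ℝ} (h0 : g 0 = 0) (hgb : g b = 0)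
    (ht₀ : t₀ ∈ Icc 0 b) (h1 : g t₀ = 1) (hle : ∀ t ∈ Icc 0 b, |g t| ≤ 1)
    (hup : ∀ t ∈ Icc 0 t₀, deriv g t = sineSpeed q (g t))
    (hdown : ∀ t ∈ Icc t₀ b, deriv g t = -sineSpeed q (g t)) : EqOn g sn (Icc 0 b) := by
  intro t ht
  rcases le_total t (genArcsin q 1) with h | h
  · obtain ⟨y, hy, rfl⟩ := exists_genArcsin_eq hq ⟨ht.1, h⟩
    rw [hinv y hy, apply_genArcsin_of_deriv_eq hq hg ht₀.1 h0 h1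
      (fun t ht => hle t ⟨ht.1, ht.2.trans ht₀.2⟩) hup hy]
  · obtain ⟨y, hy, hyt⟩ := exists_genArcsin_eq hq (t := b - t)
      ⟨by linarith [ht.2], by linarith⟩
    have h := apply_genArcsin_of_deriv_eq hq (g := fun t => g (b - t)) (t₀ := b - t₀)
      (hg.comp (contDiff_const.sub contDiff_id)) (by linarith [ht₀.2]) (by simpa using hgb)
      (by simpa using h1) (fun t ht => hle _ ⟨by linarith [ht.2, ht₀.1], by linarith [ht.1]⟩)
      (fun t ht => by
        rw [deriv_comp_const_sub, hdown _ ⟨by linarith [ht.2], by linarith [ht.1]⟩, neg_neg]) hy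
    rw [← hsym t, ← hyt, hinv y hy, ← h, hyt, sub_sub_cancel]

lemma integral_abs_rpow_of_deriv_eq (hq : 1 < q) {S : ℝ → ℝ} (hS : ContDiff ℝ 1 S)
    (hb : b = (1 + 2 / q) * betaFn (1 / 2) ((q + 1) / q)) (h0 : S 0 = 0) (hSb : S b = 0)
    {t₀ : ℝ} (ht₀ : t₀ ∈ Icc 0 b) (h1 : S t₀ = 1) (hle : ∀ t ∈ Icc 0 b, |S t| ≤ 1)
    (hd1 : ∀ t ∈ Icc 0 t₀, deriv S t = sineSpeed q (S t))
    (hd2 : ∀ t ∈ Icc t₀ b, deriv S t = -sineSpeed q (S t)) :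
    ∫ t in (0:ℝ)..b, |S t| ^ q = 2 / q * betaFn (1 / 2) ((q + 1) / q) := by
  have hb0 : 0 ≤ b := ht₀.1.trans ht₀.2
  have hcal := integral_deriv_sub_sq_add_integral_deriv_add_sq hq hS h0 hSb ht₀ h1 hle 1
  have z1 : ∫ t in (0:ℝ)..t₀, (deriv S t - 1 * sineSpeed q (S t)) ^ 2 = 0 := by
    rw [intervalIntegral.integral_congr (g := fun _ => 0), intervalIntegral.integral_zero]
    intro t ht
    rw [uIcc_of_le ht₀.1] at ht
    simp [hd1 t ht]
  have z2 : ∫ t in t₀..b, (deriv S t + 1 * sineSpeed q (S t)) ^ 2 = 0 := by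
    rw [intervalIntegral.integral_congr (g := fun _ => 0), intervalIntegral.integral_zero]
    intro t ht
    rw [uIcc_of_le ht₀.2] at ht
    simp [hd2 t ht]
  have hE : ∫ t in (0:ℝ)..b, deriv S t ^ 2 = b - ∫ t in (0:ℝ)..b, |S t| ^ q := by
    have habs : Continuous fun t => |S t| ^ q :=
      hS.continuous.abs.rpow_const fun _ => Or.inr (by linarith)
    rw [intervalIntegral.integral_congr (g := fun t => 1 - |S t| ^ q),
      intervalIntegral.integral_sub (by simp) (habs.intervalIntegrable _ _)]
    · simp
    · intro t ht
      rw [uIcc_of_le hb0] at ht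
      simp only
      rw [← sineSpeed_sq hq (hle t ht)]
      rcases le_total t t₀ with h | h
      · rw [hd1 t ⟨ht.1, h⟩]
      · rw [hd2 t ⟨h, ht.2⟩, neg_sq]
  rw [z1, z2, hE] at hcal
  linarith

end GenSine

section SecondOrder

variable {p q b : ℝ}

/-- The quotient of the `L^q` norm of `f` by the `L^p` norm of its second derivative over
`[0, b]`. -/
noncomputable def secondOrderQuotient (p q b : ℝ) (f : ℝ → ℝ) : ℝ :=
  (∫ t in (0:ℝ)..b, |f t| ^ q) ^ (1 / q) / (∫ t in (0:ℝ)..b, |deriv (deriv f) t| ^ p) ^ (1 / p)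

lemma secondOrderQuotient_congr (hb : 0 ≤ b) {f g : ℝ → ℝ} (h : EqOn f g (Icc 0 b)) :
    secondOrderQuotient p q b f = secondOrderQuotient p q b g := by
  have h1 : EqOn (fun t => |f t| ^ q) (fun t => |g t| ^ q) (Ioo 0 b) := fun t ht => by
    simp only [h (Ioo_subset_Icc_self ht)]
  have h2 : EqOn (fun t => |deriv (deriv f) t| ^ p) (fun t => |deriv (deriv g) t| ^ p)
      (Ioo 0 b) := fun t ht => by
    have he : f =ᶠ[nhds t] g := by
      filter_upwards [Icc_mem_nhds ht.1 ht.2] with s hs using h hs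
    simp only [he.deriv.deriv_eq]
  rw [secondOrderQuotient, secondOrderQuotient, integral_congr_Ioo_of_le hb h1,
    integral_congr_Ioo_of_le hb h2]

lemma rpow_integral_abs_const_mul {r : ℝ} (hr : 0 < r) (hb : 0 ≤ b) (c : ℝ) (g : ℝ → ℝ) :
    (∫ t in (0:ℝ)..b, |c * g t| ^ r) ^ (1 / r) =
      |c| * (∫ t in (0:ℝ)..b, |g t| ^ r) ^ (1 / r) := by
  simp_rw [abs_mul, Real.mul_rpow (abs_nonneg _) (abs_nonneg _)]
  rw [intervalIntegral.integral_const_mul, Real.mul_rpow (by positivity)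
    (intervalIntegral.integral_nonneg hb fun t _ => by positivity), ← Real.rpow_mul (abs_nonneg c),
    mul_one_div_cancel hr.ne', Real.rpow_one]

lemma secondOrderQuotient_const_mul (hp : 0 < p) (hq : 0 < q) (hb : 0 ≤ b) {c : ℝ} (hc : c ≠ 0)
    (g : ℝ → ℝ) :
    secondOrderQuotient p q b (fun t => c * g t) = secondOrderQuotient p q b g := by
  have h1 : deriv (fun t => c * g t) = fun t => c * deriv g t :=
    funext fun t => deriv_const_mul_field c
  have h2 : deriv (fun t => c * deriv g t) = fun t => c * deriv (deriv g) t :=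
    funext fun t => deriv_const_mul_field c
  rw [secondOrderQuotient, secondOrderQuotient, h1, h2, rpow_integral_abs_const_mul hq hb,
    rpow_integral_abs_const_mul hp hb, mul_div_mul_left _ _ (abs_ne_zero.2 hc)]

lemma memLp_abs_of_continuous {φ : ℝ → ℝ} (hφ : Continuous φ) (r : ENNReal) (a b : ℝ) :
    MemLp (fun t => |φ t|) r (volume.restrict (Ioc a b)) := by
  obtain ⟨C, hC⟩ := (isCompact_Icc (a := a) (b := b)).exists_bound_of_continuousOn
    hφ.abs.continuousOn
  refine MemLp.of_bound hφ.abs.aestronglyMeasurable C ?_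
  rw [ae_restrict_iff' measurableSet_Ioc]
  exact .of_forall fun t ht => hC t (Ioc_subset_Icc_self ht)

lemma integral_deriv_sq_le (hpq : p.HolderConjugate q) (hb : 0 ≤ b) {g : ℝ → ℝ}
    (hg : ContDiff ℝ 2 g) (h0 : g 0 = 0) (hgb : g b = 0) :
    ∫ t in (0:ℝ)..b, deriv g t ^ 2 ≤
      (∫ t in (0:ℝ)..b, |g t| ^ q) ^ (1 / q) *
        (∫ t in (0:ℝ)..b, |deriv (deriv g) t| ^ p) ^ (1 / p) := by
  have hg1 : ContDiff ℝ 1 (deriv g) := ContDiff.deriv' (n := 1) (by norm_num; exact hg)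
  have hd : Continuous (deriv g) := hg1.continuous
  have hdd : Continuous (deriv (deriv g)) := hg1.continuous_deriv_one
  have hgc := hg.continuous
  have hparts : ∫ t in (0:ℝ)..b, deriv g t ^ 2 = ∫ t in (0:ℝ)..b, -(g t * deriv (deriv g) t) := by
    have h := intervalIntegral.integral_mul_deriv_eq_deriv_mul (a := 0) (b := b) (u := g)
      (v := deriv g)
      (fun t _ => (hg.differentiable two_ne_zero t).hasDerivAt)
      (fun t _ => (hg1.differentiable one_ne_zero t).hasDerivAt)
      (hd.intervalIntegrable _ _) (hdd.intervalIntegrable _ _)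
    rw [intervalIntegral.integral_neg, h, h0, hgb]
    simp [sq]
  calc ∫ t in (0:ℝ)..b, deriv g t ^ 2
      ≤ ∫ t in (0:ℝ)..b, |g t| * |deriv (deriv g) t| := by
        rw [hparts]
        refine intervalIntegral.integral_mono_on hb
          (Continuous.intervalIntegrable (by fun_prop) _ _)
          (Continuous.intervalIntegrable (by fun_prop) _ _) fun t _ => ?_
        rw [← abs_mul]
        exact neg_le_abs _
    _ ≤ _ := by
        simp only [intervalIntegral.integral_of_le hb]
        exact integral_mul_le_Lp_mul_Lq_of_nonneg hpq.symm (.of_forall fun _ => abs_nonneg _)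
          (.of_forall fun _ => abs_nonneg _) (memLp_abs_of_continuous hgc _ _ _)
          (memLp_abs_of_continuous hdd _ _ _)

/-- The sharp constant of the second-order embedding. -/
noncomputable def secondOrderConst (p q : ℝ) : ℝ :=
  (2 / q) ^ (2 / q) * betaFn (1 / 2) ((q + 1) / q) ^ (1 / q - 1 / p)

lemma one_div_sub_one_div (hpq : p.HolderConjugate q) : 1 / q - 1 / p = 2 / q - 1 := by
  have := hpq.inv_add_inv_eq_one
  rw [one_div, one_div, div_eq_mul_inv]
  linarith

lemma secondOrderConst_mul (hpq : p.HolderConjugate q) :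
    secondOrderConst p q * betaFn (1 / 2) ((q + 1) / q) =
      (2 / q * betaFn (1 / 2) ((q + 1) / q)) ^ (2 / q) := by
  have hB := betaFn_pos hpq.symm.lt
  have hq : 0 < 2 / q := div_pos two_pos hpq.symm.pos
  rw [secondOrderConst, one_div_sub_one_div hpq, Real.rpow_sub_one hB.ne',
    Real.mul_rpow hq.le hB.le]
  field_simp

/-- Sharp second-order inequality for functions normalised by their maximum modulus. -/
lemma secondOrderQuotient_le_of_normalized (hpq : p.HolderConjugate q) {g : ℝ → ℝ}
    (hg : ContDiff ℝ 2 g) {t₀ : ℝ} (hbq : b = (1 + 2 / q) * betaFn (1 / 2) ((q + 1) / q))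
    (h0 : g 0 = 0) (hb : g b = 0) (ht₀ : t₀ ∈ Icc 0 b)
    (h1 : g t₀ = 1) (hle : ∀ t ∈ Icc 0 b, |g t| ≤ 1) :
    secondOrderQuotient p q b g ≤ secondOrderConst p q ∧
      (secondOrderQuotient p q b g = secondOrderConst p q →
        (∀ t ∈ Icc 0 t₀, deriv g t = sineSpeed q (g t)) ∧
        ∀ t ∈ Icc t₀ b, deriv g t = -sineSpeed q (g t)) := by
  have hq := hpq.symm.lt
  have hq0 : 0 < q := hpq.symm.pos
  have hB := betaFn_pos hq
  have hb0 : 0 < b := by rw [hbq]; positivity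
  obtain ⟨hsob, hsob_eq⟩ :=
    sharp_energy_bound hq (hg.of_le one_le_two) hbq h0 hb ht₀ h1 hle
  have hhol := integral_deriv_sq_le hpq hb0.le hg h0 hb
  have hconst := secondOrderConst_mul hpq
  have habs : Continuous fun t => |g t| ^ q :=
    hg.continuous.abs.rpow_const fun _ => Or.inr hq0.le
  have hN : 0 < ∫ t in (0:ℝ)..b, |g t| ^ q :=
    intervalIntegral.integral_pos hb0 habs.continuousOn (fun t _ => by positivity)
      ⟨t₀, ht₀, by simp [h1]⟩
  have hd0 : 0 ≤ (∫ t in (0:ℝ)..b, |deriv (deriv g) t| ^ p) ^ (1 / p) :=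
    Real.rpow_nonneg (intervalIntegral.integral_nonneg hb0.le fun t _ => by positivity) _
  rw [Real.div_rpow (by positivity) hN.le, ← hconst] at hsob hsob_eq
  have hn0 : 0 < (∫ t in (0:ℝ)..b, |g t| ^ q) ^ (1 / q) := Real.rpow_pos_of_pos hN _
  have hnsq : (∫ t in (0:ℝ)..b, |g t| ^ q) ^ (2 / q) =
      ((∫ t in (0:ℝ)..b, |g t| ^ q) ^ (1 / q)) ^ 2 := by
    rw [← Real.rpow_mul_natCast hN.le]
    congr 1
    push_cast
    ring
  have hC0 : 0 < secondOrderConst p q := by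
    have := div_pos two_pos hq0
    unfold secondOrderConst
    positivity
  rw [hnsq] at hsob hsob_eq
  unfold secondOrderQuotient
  set n := (∫ t in (0:ℝ)..b, |g t| ^ q) ^ (1 / q)
  set d := (∫ t in (0:ℝ)..b, |deriv (deriv g) t| ^ p) ^ (1 / p)
  set E := ∫ t in (0:ℝ)..b, deriv g t ^ 2
  set B := betaFn (1 / 2) ((q + 1) / q)
  set C := secondOrderConst p q
  have hsob' : n ^ 2 ≤ E * C := by
    rw [← mul_div_assoc, le_div_iff₀ (by positivity)] at hsob
    nlinarith
  have hnd : n ≤ C * d := by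
    have : n * n ≤ n * (C * d) := by nlinarith
    exact le_of_mul_le_mul_left this hn0
  have hd : 0 < d := hd0.lt_of_ne fun h => by rw [← h] at hnd; linarith
  refine ⟨(div_le_iff₀ hd).2 hnd, fun h => hsob_eq ?_⟩
  rw [div_eq_iff hd.ne'] at h
  have hEC : E * C = n ^ 2 := by
    refine le_antisymm ?_ hsob'
    nlinarith
  rw [← mul_div_assoc, eq_div_iff (by positivity)]
  linear_combination -B * hEC

lemma secondOrderQuotient_of_deriv_deriv_eq (hpq : p.HolderConjugate q) (hb : 0 ≤ b) {S : ℝ → ℝ}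
    (hnn : ∀ t ∈ Icc 0 b, 0 ≤ S t)
    (hdd : ∀ t ∈ Icc 0 b, deriv (deriv S) t = -(q / 2) * S t ^ (q - 1))
    (hN : ∫ t in (0:ℝ)..b, |S t| ^ q = 2 / q * betaFn (1 / 2) ((q + 1) / q)) :
    secondOrderQuotient p q b S = secondOrderConst p q := by
  have hq := hpq.symm.pos
  have hq2 : 0 < q / 2 := by positivity
  have hB := betaFn_pos hpq.symm.lt
  have hD : ∫ t in (0:ℝ)..b, |deriv (deriv S) t| ^ p =
      (q / 2) ^ p * ∫ t in (0:ℝ)..b, |S t| ^ q := by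
    rw [← intervalIntegral.integral_const_mul]
    refine intervalIntegral.integral_congr fun t ht => ?_
    rw [uIcc_of_le hb] at ht
    rw [hdd t ht, abs_mul, abs_neg, abs_of_pos hq2,
      abs_of_nonneg (Real.rpow_nonneg (hnn t ht) _),
      Real.mul_rpow hq2.le (Real.rpow_nonneg (hnn t ht) _), ← Real.rpow_mul (hnn t ht),
      hpq.symm.sub_one_mul_conj, abs_of_nonneg (hnn t ht)]
  have hr : (0:ℝ) < 2 / q := by positivity
  rw [secondOrderQuotient, hD, hN, Real.mul_rpow (x := (q / 2) ^ p) (by positivity) (by positivity),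
    ← Real.rpow_mul hq2.le, mul_one_div_cancel hpq.ne_zero, Real.rpow_one, mul_comm (q / 2),
    ← div_div, ← Real.rpow_sub (by positivity), secondOrderConst, one_div_sub_one_div hpq,
    Real.mul_rpow hr.le hB.le, Real.rpow_sub_one hr.ne']
  field_simp

/-- The sharp second-order embedding, with its extremal functions. -/
theorem secondOrder_embedding (hpq : p.HolderConjugate q) {sn : ℝ → ℝ}
    (hb : b = 2 * genArcsin q 1) (hinv : ∀ y ∈ Icc (0:ℝ) 1, sn (genArcsin q y) = y)
    (hsym : ∀ x, sn (b - x) = sn x) :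
    IsGreatest {x : ℝ | ∃ f : ℝ → ℝ, ContDiff ℝ 2 f ∧ f 0 = 0 ∧ f b = 0 ∧
        (∃ t ∈ Icc (0:ℝ) b, f t ≠ 0) ∧ x = secondOrderQuotient p q b f}
      (secondOrderConst p q) ∧
    ∀ f : ℝ → ℝ, ContDiff ℝ 2 f → f 0 = 0 → f b = 0 → (∃ t ∈ Icc (0:ℝ) b, f t ≠ 0) →
      (secondOrderQuotient p q b f = secondOrderConst p q ↔
        ∃ c : ℝ, c ≠ 0 ∧ ∀ t ∈ Icc (0:ℝ) b, f t = c * sn t) := by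
  have hq := hpq.symm.lt
  have hq0 := hpq.symm.pos
  have hT := genArcsin_one_pos hq
  have hb0 : 0 < b := by linarith
  have hbT : b / 2 = genArcsin q 1 := by linarith
  have hbq : b = (1 + 2 / q) * betaFn (1 / 2) ((q + 1) / q) := by
    rw [hb, two_mul_genArcsin_one hq]
  have hmem := fun {t} => genSine_mem_Icc hq hb hinv hsym (t := t)
  obtain ⟨S, hS, hSsn, hd1, hd2, hdd⟩ := exists_contDiff_extension_genSine hq hb hinv hsym
  have hhalf : b / 2 ∈ Icc 0 b := ⟨by linarith, by linarith⟩
  have hS0 : S 0 = 0 := by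
    rw [hSsn 0 ⟨le_rfl, hb0.le⟩]
    simpa [genArcsin_zero] using hinv 0 (by simp)
  have hSb : S b = 0 := by
    rw [hSsn b ⟨hb0.le, le_rfl⟩, ← hS0, hSsn 0 ⟨le_rfl, hb0.le⟩]
    simpa using (hsym b).symm
  have hS1 : S (b / 2) = 1 := by
    rw [hSsn _ hhalf, hbT]
    exact hinv 1 (by simp)
  have hSmem : ∀ t ∈ Icc 0 b, S t ∈ Icc (0:ℝ) 1 := fun t ht => by
    rw [hSsn t ht]; exact hmem ht
  have hSN := integral_abs_rpow_of_deriv_eq hq (hS.of_le one_le_two) hbq hS0 hSb hhalf hS1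
    (fun t ht => by rw [abs_of_nonneg (hSmem t ht).1]; exact (hSmem t ht).2) hd1 hd2
  have hSq : secondOrderQuotient p q b S = secondOrderConst p q :=
    secondOrderQuotient_of_deriv_deriv_eq hpq hb0.le (fun t ht => (hSmem t ht).1) hdd hSN
  have hnormalize : ∀ f : ℝ → ℝ, ContDiff ℝ 2 f → (∃ t ∈ Icc (0:ℝ) b, f t ≠ 0) →
      ∃ t₀ ∈ Icc 0 b, f t₀ ≠ 0 ∧ ∀ t ∈ Icc 0 b, |(f t₀)⁻¹ * f t| ≤ 1 := by
    rintro f hf ⟨s, hs, hfs⟩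
    obtain ⟨t₀, ht₀, hmax⟩ := isCompact_Icc.exists_isMaxOn ⟨s, hs⟩ hf.continuous.abs.continuousOn
    have hpos : 0 < |f t₀| := (abs_pos.2 hfs).trans_le (hmax hs)
    refine ⟨t₀, ht₀, abs_pos.1 hpos, fun t ht => ?_⟩
    rw [abs_mul, abs_inv, inv_mul_le_iff₀ hpos, mul_one]
    exact hmax ht
  have hquot : ∀ (f : ℝ → ℝ) (c : ℝ), c ≠ 0 →
      secondOrderQuotient p q b (fun t => c * f t) = secondOrderQuotient p q b f :=
    fun f c hc => secondOrderQuotient_const_mul hpq.pos hq0 hb0.le hc f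
  refine ⟨⟨⟨S, hS, hS0, hSb, ⟨b / 2, hhalf, by simp [hS1]⟩, hSq.symm⟩, ?_⟩, ?_⟩
  · rintro _ ⟨f, hf, hf0, hfb, hne, rfl⟩
    obtain ⟨t₀, ht₀, hft₀, hle⟩ := hnormalize f hf hne
    rw [← hquot f _ (inv_ne_zero hft₀)]
    exact (secondOrderQuotient_le_of_normalized hpq (contDiff_const.mul hf) hbq (by simp [hf0])
      (by simp [hfb]) ht₀ (inv_mul_cancel₀ hft₀) hle).1
  · intro f hf hf0 hfb hne
    constructor
    · intro h
      obtain ⟨t₀, ht₀, hft₀, hle⟩ := hnormalize f hf hne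
      refine ⟨f t₀, hft₀, ?_⟩
      rw [← hquot f _ (inv_ne_zero hft₀)] at h
      have hg : ContDiff ℝ 2 fun t => (f t₀)⁻¹ * f t := contDiff_const.mul hf
      obtain ⟨hup, hdown⟩ := (secondOrderQuotient_le_of_normalized hpq hg hbq (by simp [hf0])
        (by simp [hfb]) ht₀ (inv_mul_cancel₀ hft₀) hle).2 h
      suffices hgsn : ∀ t ∈ Icc 0 b, (f t₀)⁻¹ * f t = sn t by
        intro t ht
        rw [← hgsn t ht, mul_inv_cancel_left₀ hft₀]
      exact eqOn_genSine_of_deriv_eq hq hb hinv hsym (hg.of_le one_le_two) (by simp [hf0])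
        (by simp [hfb]) ht₀ (inv_mul_cancel₀ hft₀) hle hup hdown
    · rintro ⟨c, hc, hfc⟩
      rw [secondOrderQuotient_congr (g := fun t => c * S t) hb0.le
        fun t ht => by simp only [hfc t ht, hSsn t ht], hquot S c hc, hSq]

end SecondOrder

/-- for I = [0, π_{2,p'}], the norm of E₂ : W^{2,p}_D(I) → L^{p'}(I) equals
(2/p')^{2/p'}·B(1/2,(p'+1)/p')^{1/p'-1/p}, with extremals exactly the nonzero scalar
multiples of sin_{2,p'}. -/
theorem stmt19 (p : ℝ) (hp : 1 < p) (sn : ℝ → ℝ) (π₀ : ℝ)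
    (hπ : π₀ = 2 * ∫ t in (0:ℝ)..1, (1 - t ^ (p / (p - 1))) ^ (-(1/2 : ℝ)))
    (hinv : ∀ y ∈ Set.Icc (0:ℝ) 1,
      sn (∫ t in (0:ℝ)..y, (1 - t ^ (p / (p - 1))) ^ (-(1/2 : ℝ))) = y)
    (hsym : ∀ x, sn (π₀ - x) = sn x) :
    IsGreatest {x : ℝ | ∃ f : ℝ → ℝ, ContDiff ℝ 2 f ∧ f 0 = 0 ∧ f π₀ = 0 ∧
        (∃ t ∈ Set.Icc (0:ℝ) π₀, f t ≠ 0) ∧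
        x = (∫ t in (0:ℝ)..π₀, |f t| ^ (p / (p - 1))) ^ (1 / (p / (p - 1))) /
              (∫ t in (0:ℝ)..π₀, |deriv (deriv f) t| ^ p) ^ (1 / p)}
      ((2 / (p / (p - 1))) ^ (2 / (p / (p - 1))) *
        betaFn (1/2) ((p / (p - 1) + 1) / (p / (p - 1))) ^ (1 / (p / (p - 1)) - 1 / p)) ∧
    ∀ f : ℝ → ℝ, ContDiff ℝ 2 f → f 0 = 0 → f π₀ = 0 →
      (∃ t ∈ Set.Icc (0:ℝ) π₀, f t ≠ 0) →
      ((∫ t in (0:ℝ)..π₀, |f t| ^ (p / (p - 1))) ^ (1 / (p / (p - 1))) /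
          (∫ t in (0:ℝ)..π₀, |deriv (deriv f) t| ^ p) ^ (1 / p) =
        (2 / (p / (p - 1))) ^ (2 / (p / (p - 1))) *
          betaFn (1/2) ((p / (p - 1) + 1) / (p / (p - 1))) ^ (1 / (p / (p - 1)) - 1 / p) ↔
        ∃ c : ℝ, c ≠ 0 ∧ ∀ t ∈ Set.Icc (0:ℝ) π₀, f t = c * sn t) := by
  have h := secondOrder_embedding (Real.HolderConjugate.conjExponent hp) (sn := sn) (b := π₀)
    hπ hinv hsym
  exact h
end
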